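/- arXiv:1610.08299 — 5 statements merged into one kernel-verified Lean document; each statement's English description precedes it below -/
import Mathlib

section
/- Let β be a real algebraic number with β > 1, and let A = {m, m+1, …, M} be a finite set of contiguous integers containing 0 and 1 (i.e., m ≤ 0 < M). If addition on Fin_A(β) can be performed in parallel, then the cardinality of A satisfies #A ≥ ⌈β⌉. -/
open scoped Pointwise

/-- The value `∑_{j ∈ ℤ} u_j β^j` of a (finitely supported) bi-infinite digit string. -/
noncomputable def seqValue (β : ℝ) (u : ℤ → ℝ) : ℝ := ∑ᶠ j : ℤ, u j * β ^ j

/-- `φ` is a `p`-local function realized by `Φ` (with memory `r` and anticipation `t`,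
`p = r + t + 1`, and `(φ u) j = Φ (u_{j+t}, …, u_{j-r})`). -/
def IsLocallyRealized (p : ℕ) (φ : (ℤ → ℝ) → ℤ → ℝ) (Φ : (Fin p → ℝ) → ℝ) : Prop :=
  ∃ r t : ℕ, p = r + t + 1 ∧
    ∀ (u : ℤ → ℝ) (j : ℤ), φ u j = Φ (fun i => u (j + (t : ℤ) - ((i : ℕ) : ℤ)))

/-- `φ` is a digit set conversion in base `β` from alphabet `A` to alphabet `B`:
it maps `A`-valued strings to `B`-valued strings, preserves finiteness of support,
and preserves the represented value. -/
def IsDigitSetConversion (β : ℝ) (A B : Set ℝ) (φ : (ℤ → ℝ) → ℤ → ℝ) : Prop :=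
  (∀ u : ℤ → ℝ, (∀ j, u j ∈ A) → ∀ j, φ u j ∈ B) ∧
  ∀ u : ℤ → ℝ, (∀ j, u j ∈ A) → (Function.support u).Finite →
    (Function.support (φ u)).Finite ∧ seqValue β (φ u) = seqValue β u

/-- There is a digit set conversion in base `β` from `A` to `B` computable in parallel. -/
def ParallelConversion (β : ℝ) (A B : Set ℝ) : Prop :=
  ∃ (p : ℕ) (φ : (ℤ → ℝ) → ℤ → ℝ) (Φ : (Fin p → ℝ) → ℝ),
    IsLocallyRealized p φ Φ ∧ IsDigitSetConversion β A B φ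

/-- Addition on `Fin_A(β)` can be performed in parallel: there is a parallel digit set
conversion from `A + A` to `A`. -/
def ParallelAddition (β : ℝ) (A : Set ℝ) : Prop :=
  ParallelConversion β (A + A) A

/-- The alphabet of contiguous integers `{m, …, M}`, viewed inside `ℝ`. -/
def intAlphabet (m M : ℤ) : Set ℝ := (fun k : ℤ => (k : ℝ)) '' Set.Icc m M

/-- `x` is represented in base `β` by an integer digit string with digits in `{m, …, M}`,
vanishing outside the positions `[-s, n)`. -/
def HasRepr (β : ℝ) (m M : ℤ) (s n : ℕ) (x : ℝ) : Prop :=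
  ∃ v : ℤ → ℤ, (∀ j, v j ∈ Finset.Icc m M) ∧ (∀ j, j ∉ Finset.Ico (-(s : ℤ)) n → v j = 0) ∧
    seqValue β (fun j => (v j : ℝ)) = x

theorem finite_support_of_eq_zero {u : ℤ → ℝ} {s : Finset ℤ} (h : ∀ j, j ∉ s → u j = 0) :
    (Function.support u).Finite :=
  s.finite_toSet.subset fun j hj => by
    by_contra hjs
    exact hj (h j hjs)

theorem seqValue_add {β : ℝ} {u v : ℤ → ℝ} (hu : (Function.support u).Finite)
    (hv : (Function.support v).Finite) :
    seqValue β (fun j => u j + v j) = seqValue β u + seqValue β v := by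
  unfold seqValue
  simp only [add_mul]
  exact finsum_add_distrib (hu.subset (Function.support_mul_subset_left _ _))
    (hv.subset (Function.support_mul_subset_left _ _))

theorem seqValue_single (β d : ℝ) (n : ℤ) :
    seqValue β (fun j => if j = n then d else 0) = d * β ^ n := by
  unfold seqValue
  rw [finsum_eq_single _ n fun j hj => by simp [hj]]
  simp

theorem mem_intAlphabet {m M k : ℤ} (hk : k ∈ Finset.Icc m M) : (k : ℝ) ∈ intAlphabet m M :=
  ⟨k, by simpa using hk, rfl⟩

/-- A finiteness-preserving local function maps the zero window to zero. -/
theorem IsLocallyRealized.apply_zero {β : ℝ} {A B : Set ℝ} {p : ℕ} {φ : (ℤ → ℝ) → ℤ → ℝ}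
    {Φ : (Fin p → ℝ) → ℝ} (hloc : IsLocallyRealized p φ Φ) (hφ : IsDigitSetConversion β A B φ)
    (h0 : (0 : ℝ) ∈ A) : Φ (fun _ => 0) = 0 := by
  obtain ⟨r, t, -, hΦ⟩ := hloc
  have hfin := (hφ.2 (fun _ => 0) (fun _ => h0) (by simp)).1
  by_contra hne
  refine Set.infinite_univ (hfin.subset fun j _ => ?_)
  simpa [hΦ] using hne

theorem ParallelAddition.exists_hasRepr_add {β : ℝ} {m M : ℤ} (hm : m ≤ 0) (hM : 0 < M)
    (h : ParallelAddition β (intAlphabet m M)) :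
    ∃ r t : ℕ, ∀ (s n : ℕ) (x y : ℝ), HasRepr β m M s n x → HasRepr β m M s n y →
      HasRepr β m M (s + t) (n + r) (x + y) := by
  obtain ⟨p, φ, Φ, hloc, hφ⟩ := h
  have h0 : (0 : ℝ) ∈ intAlphabet m M + intAlphabet m M :=
    ⟨0, ⟨0, ⟨hm, hM.le⟩, by simp⟩, 0, ⟨0, ⟨hm, hM.le⟩, by simp⟩, by simp⟩
  have hz := hloc.apply_zero hφ h0
  obtain ⟨r, t, hp, hΦ⟩ := hloc
  refine ⟨r, t, ?_⟩
  rintro s n x y ⟨v, hvA, hv0, rfl⟩ ⟨w, hwA, hw0, rfl⟩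
  set u : ℤ → ℝ := fun j => (v j : ℝ) + (w j : ℝ) with hu
  have huA : ∀ j, u j ∈ intAlphabet m M + intAlphabet m M := fun j =>
    Set.add_mem_add (mem_intAlphabet (hvA j)) (mem_intAlphabet (hwA j))
  have hu0 : ∀ j, j ∉ Finset.Ico (-(s : ℤ)) n → u j = 0 := fun j hj => by
    simp [hu, hv0 j hj, hw0 j hj]
  choose z hz1 hz2 using hφ.1 u huA
  simp only at hz2
  refine ⟨z, fun j => by simpa using hz1 j, fun j hj => ?_, ?_⟩
  · have : φ u j = 0 := by
      rw [hΦ, ← hz]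
      congr 1
      funext i
      apply hu0
      have := i.2
      simp only [Finset.mem_Ico] at hj ⊢
      push_cast at hj
      omega
    exact_mod_cast (hz2 j).trans this
  · simp only [hz2]
    rw [← seqValue_add (finite_support_of_eq_zero fun j hj => by simpa using hv0 j hj)
      (finite_support_of_eq_zero fun j hj => by simpa using hw0 j hj)]
    exact (hφ.2 u huA (finite_support_of_eq_zero hu0)).2

/-- Nonnegative digit strings with digits at most `2 ^ k` can be rewritten over `{m, …, M}`,
lengthening the string by an amount depending only on `k`. -/
theorem hasRepr_of_le_two_pow {β : ℝ} {m M : ℤ} {r t : ℕ} (hm : m ≤ 0) (hM : 0 < M)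
    (hadd : ∀ (s n : ℕ) (x y : ℝ), HasRepr β m M s n x → HasRepr β m M s n y →
      HasRepr β m M (s + t) (n + r) (x + y)) (n k : ℕ) (d : ℤ → ℕ) (hd : ∀ j, d j ≤ 2 ^ k)
    (hd0 : ∀ j, j ∉ Finset.Ico (0 : ℤ) n → d j = 0) :
    HasRepr β m M (k * t) (n + k * r) (seqValue β fun j => (d j : ℝ)) := by
  induction k generalizing d with
  | zero =>
    refine ⟨fun j => d j, fun j => ?_, fun j hj => ?_, by simp⟩
    · have := hd j
      simp only [Finset.mem_Icc]
      omega
    · have := hd0 j (by simpa using hj)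
      simp [this]
  | succ k ih =>
    have h1 := ih (fun j => d j / 2) (fun j => by have := hd j; rw [pow_succ] at this; omega)
      (fun j hj => by simp [hd0 j hj])
    have h2 := ih (fun j => d j - d j / 2) (fun j => by have := hd j; rw [pow_succ] at this; omega)
      (fun j hj => by simp [hd0 j hj])
    have h3 := hadd _ _ _ _ h1 h2
    rw [← seqValue_add
      (finite_support_of_eq_zero (s := Finset.Ico (0 : ℤ) n) fun j hj => by simp [hd0 j hj])
      (finite_support_of_eq_zero (s := Finset.Ico (0 : ℤ) n) fun j hj => by simp [hd0 j hj])] at h3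
    convert h3 using 1
    · ring
    · ring
    · congr 1
      funext j
      have : d j = d j / 2 + (d j - d j / 2) := by omega
      exact_mod_cast this

/-- Greedy expansion: a real in `[0, β ^ n)` is approximated from below, within `1`,
by the value of a string of length `n` with digits at most `⌊β⌋`. -/
theorem exists_greedy_expansion {β : ℝ} (hβ : 1 < β) (n : ℕ) (x : ℝ) (hx : 0 ≤ x)
    (hxn : x < β ^ n) :
    ∃ d : ℤ → ℕ, (∀ j, d j ≤ ⌊β⌋₊) ∧ (∀ j, j ∉ Finset.Ico (0 : ℤ) n → d j = 0) ∧
      seqValue β (fun j => (d j : ℝ)) ≤ x ∧ x < seqValue β (fun j => (d j : ℝ)) + 1 := by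
  induction n generalizing x with
  | zero =>
    refine ⟨fun _ => 0, by simp, by simp, ?_⟩
    simpa [seqValue] using ⟨hx, hxn⟩
  | succ n ih =>
    have hpos : 0 < β ^ n := by positivity
    set q : ℕ := ⌊x / β ^ n⌋₊ with hq
    have hq1 : (q : ℝ) * β ^ n ≤ x := (le_div_iff₀ hpos).1 (Nat.floor_le (by positivity))
    have hq2 : x < ((q : ℝ) + 1) * β ^ n := (div_lt_iff₀ hpos).1 (Nat.lt_floor_add_one _)
    have hqβ : q ≤ ⌊β⌋₊ := Nat.floor_le_floor
      (((div_lt_iff₀ hpos).2 (by rw [pow_succ'] at hxn; exact hxn)).le)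
    obtain ⟨d, hd, hd0, hle, hlt⟩ := ih (x - q * β ^ n) (by linarith) (by linarith)
    have hval : seqValue β (fun j => ((d j + if j = (n : ℤ) then q else 0 : ℕ) : ℝ)) =
        seqValue β (fun j => (d j : ℝ)) + q * β ^ n := by
      rw [← zpow_natCast β n, ← seqValue_single,
        ← seqValue_add (finite_support_of_eq_zero fun j hj => by simpa using hd0 j hj)
          (finite_support_of_eq_zero (s := {(n : ℤ)}) fun j hj => by
            simpa using fun h => absurd h (by simpa using hj))]
      push_cast
      rfl
    refine ⟨fun j => d j + if j = (n : ℤ) then q else 0, fun j => ?_, fun j hj => ?_, ?_, ?_⟩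
    · by_cases hj : j = (n : ℤ)
      · have := hd0 j (by simp [hj])
        simpa [hj, hj ▸ this] using hqβ
      · simpa [hj] using hd j
    · simp only [Finset.mem_Ico] at hj
      push_cast at hj
      have h1 : j ≠ n := by omega
      have h2 := hd0 j (by simp only [Finset.mem_Ico]; omega)
      simp [h1, h2]
    · rw [hval]; linarith
    · rw [hval]; linarith

/-- Values with pairwise distinct representations are bounded in number by the number of
digit strings. -/
theorem card_le_of_hasRepr {β : ℝ} {m M : ℤ} {s n N : ℕ} (y : Fin N → ℝ)
    (hy : Function.Injective y) (h : ∀ i, HasRepr β m M s n (y i)) :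
    N ≤ (M + 1 - m).toNat ^ (n + s) := by
  choose v hvA hv0 hval using h
  let f : Fin N → (Finset.Ico (-(s : ℤ)) n → Finset.Icc m M) := fun i j => ⟨v i j, hvA i j⟩
  have hf : Function.Injective f := fun a b hab => by
    apply hy
    rw [← hval a, ← hval b]
    congr 1
    funext j
    by_cases hj : j ∈ Finset.Ico (-(s : ℤ)) n
    · have := congrArg Subtype.val (congrFun hab ⟨j, hj⟩)
      simpa [f] using this
    · rw [hv0 a j hj, hv0 b j hj]
  have hcard := Fintype.card_le_of_injective f hf
  have hlen : ((n : ℤ) - -(s : ℤ)).toNat = n + s := by omega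
  rwa [Fintype.card_fun, Fintype.card_coe, Fintype.card_coe, Fintype.card_fin, Int.card_Icc,
    Int.card_Ico, hlen] at hcard

theorem le_of_pow_le_mul_pow {a b C : ℝ} (hb : 0 < b) (h : ∀ n : ℕ, a ^ n ≤ C * b ^ n) :
    a ≤ b := by
  by_contra! hab
  obtain ⟨n, hn⟩ := pow_unbounded_of_one_lt C ((one_lt_div hb).2 hab)
  rw [div_pow, lt_div_iff₀ (by positivity)] at hn
  exact (h n).not_gt hn

/-- If `β > 1` is a real algebraic number and the alphabet `{m, …, M}` of contiguous
integers containing `0` and `1` allows parallel addition in base `β`, then its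
cardinality `M - m + 1` is at least `⌈β⌉`. -/
theorem card_ge_ceil_of_parallelAddition
    (β : ℝ) (hβalg : IsAlgebraic ℚ β) (hβ : 1 < β)
    (m M : ℤ) (hm : m ≤ 0) (hM : 0 < M)
    (h : ParallelAddition β (intAlphabet m M)) :
    ⌈β⌉ ≤ M - m + 1 := by
  obtain ⟨r, t, hadd⟩ := h.exists_hasRepr_add hm hM
  set k : ℕ := ⌊β⌋₊
  set c : ℕ := (M + 1 - m).toNat with hc
  have hcpos : 0 < c := by omega
  have hcount : ∀ n : ℕ, β ^ n ≤ (c : ℝ) ^ (k * r + k * t) * (c : ℝ) ^ n := fun n => by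
    have hlt : ∀ i : Fin ⌈β ^ n⌉₊, ((i : ℕ) : ℝ) < β ^ n := fun i => Nat.lt_ceil.1 i.2
    choose d hd hd0 hle hgt using fun i : Fin ⌈β ^ n⌉₊ =>
      exists_greedy_expansion hβ n (i : ℕ) (Nat.cast_nonneg _) (hlt i)
    have hinj : Function.Injective fun i => seqValue β fun j => (d i j : ℝ) := fun a b hab => by
      simp only at hab
      have h1 : ((a : ℕ) : ℝ) < (b : ℕ) + 1 := by linarith [hgt a, hle b]
      have h2 : ((b : ℕ) : ℝ) < (a : ℕ) + 1 := by linarith [hgt b, hle a]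
      norm_cast at h1 h2
      omega
    have hcard := card_le_of_hasRepr _ hinj fun i =>
      hasRepr_of_le_two_pow hm hM hadd n k (d i)
        (fun j => (hd i j).trans Nat.lt_two_pow_self.le) (hd0 i)
    calc β ^ n ≤ (⌈β ^ n⌉₊ : ℝ) := Nat.le_ceil _
      _ ≤ (c : ℝ) ^ (n + k * r + k * t) := by exact_mod_cast hcard
      _ = _ := by ring
  have hle : β ≤ (c : ℝ) := le_of_pow_le_mul_pow (by exact_mod_cast hcpos) hcount
  have hcz : (c : ℤ) = M - m + 1 := by omega
  rw [← hcz]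
  exact Int.ceil_le.2 (by exact_mod_cast hle)
end

section
/- Let β be a real algebraic integer with β > 1, with minimal polynomial f(X) ∈ ℤ[X]. Let A be a finite set of contiguous integers containing 0 and 1. If addition on Fin_A(β) is computable in parallel, then #A ≥ |f(1)| + 2. -/
open scoped Pointwise

/-- An integral relation `∑ d_j β^j = e` forces `∑ d_j ≡ e` modulo `f(1)`, where `f` is the
minimal polynomial of `β`. -/
lemma minpoly_eval_one_dvd_sum_sub {β : ℝ} (hβint : IsIntegral ℤ β) (hβ : β ≠ 0) (s : Finset ℤ)
    (K : ℕ) (hs : ∀ j ∈ s, -(K : ℤ) ≤ j) (d : ℤ → ℤ) (e : ℤ)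
    (h : ∑ j ∈ s, (d j : ℝ) * β ^ j = e) :
    (minpoly ℤ β).eval 1 ∣ ∑ j ∈ s, d j - e := by
  open Polynomial in
  let P : ℤ[X] := ∑ j ∈ s, C (d j) * X ^ (j + K).toNat - C e * X ^ K
  have hP : Polynomial.aeval β P = 0 := by
    have hterm : ∀ j ∈ s, (d j : ℝ) * β ^ (j + K).toNat = (d j : ℝ) * β ^ j * β ^ K := by
      intro j hj
      have hj' := hs j hj
      rw [mul_assoc, ← zpow_natCast, ← zpow_natCast β K, ← zpow_add₀ hβ,
        Int.toNat_of_nonneg (by omega)]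
    simp only [P, map_sub, map_sum, map_mul, map_pow, Polynomial.aeval_X, eq_intCast,
      map_intCast]
    rw [Finset.sum_congr rfl hterm, ← Finset.sum_mul, h, sub_self]
  have hdvd := Polynomial.eval_dvd (x := 1) (minpoly.isIntegrallyClosed_dvd hβint hP)
  simpa [P, Polynomial.eval_finsetSum] using hdvd

/-- A local function sends strings that agree on the window around `j` to equal digits at `j`. -/
lemma local_congr {φ : (ℤ → ℝ) → ℤ → ℝ} {r t : ℕ} {Φ : (Fin (r + t + 1) → ℝ) → ℝ}
    (hΦ : ∀ (u : ℤ → ℝ) (j : ℤ), φ u j = Φ (fun i => u (j + (t : ℤ) - ((i : ℕ) : ℤ))))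
    {u w : ℤ → ℝ} {j k : ℤ} (h : ∀ i : ℤ, -r ≤ i → i ≤ t → u (j + i) = w (k + i)) :
    φ u j = φ w k := by
  rw [hΦ, hΦ]
  congr 1
  funext i
  have hi := i.isLt
  have := h (t - (i : ℕ)) (by omega) (by omega)
  rwa [← add_sub_assoc, ← add_sub_assoc] at this

/-- Changing a single digit of a finite string only affects a window of its image, and the value
of the change is preserved. -/
lemma sum_window_sub {β : ℝ} {S B : Set ℝ} {φ : (ℤ → ℝ) → ℤ → ℝ} {r t : ℕ}
    {Φ : (Fin (r + t + 1) → ℝ) → ℝ}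
    (hΦ : ∀ (u : ℤ → ℝ) (j : ℤ), φ u j = Φ (fun i => u (j + (t : ℤ) - ((i : ℕ) : ℤ))))
    (hφ : IsDigitSetConversion β S B φ) {u w : ℤ → ℝ} (hu : ∀ j, u j ∈ S) (hw : ∀ j, w j ∈ S)
    (hus : (Function.support u).Finite) (hws : (Function.support w).Finite)
    (huw : ∀ j, j ≠ 0 → u j = w j) :
    ∑ j ∈ Finset.Icc (-(t : ℤ)) r, (φ u j - φ w j) * β ^ j = u 0 - w 0 := by
  have hfin : ∀ v : ℤ → ℝ, (Function.support v).Finite →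
      (Function.support fun j => v j * β ^ j).Finite := fun v hv =>
    hv.subset (Function.support_mul_subset_left _ _)
  have hsub : ∀ a b : ℤ → ℝ, (Function.support a).Finite → (Function.support b).Finite →
      ∑ᶠ j : ℤ, (a j - b j) * β ^ j = seqValue β a - seqValue β b := by
    intro a b ha hb
    simp only [sub_mul]
    exact finsum_sub_distrib (hfin a ha) (hfin b hb)
  obtain ⟨hu1, hu2⟩ := hφ.2 u hu hus
  obtain ⟨hw1, hw2⟩ := hφ.2 w hw hws
  have h1 : ∑ᶠ j : ℤ, (φ u j - φ w j) * β ^ j = ∑ᶠ j : ℤ, (u j - w j) * β ^ j := by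
    rw [hsub _ _ hu1 hw1, hsub _ _ hus hws, hu2, hw2]
  rw [finsum_eq_single (fun j : ℤ => (u j - w j) * β ^ j) 0
    (fun j hj => by rw [huw j hj, sub_self, zero_mul])] at h1
  rw [← finsum_eq_sum_of_support_subset, h1, zpow_zero, mul_one]
  intro j hj
  by_contra hj'
  refine hj ?_
  have : φ u j = φ w j := by
    refine local_congr hΦ fun i hi hi' => huw _ fun h0 => hj' ?_
    simp only [Finset.coe_Icc, Set.mem_Icc]
    omega
  simp [this]

/-- A sequence which takes the value `a` on `[k, l]` and vanishes elsewhere. -/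
noncomputable def blockString (a : ℝ) (k l : ℤ) : ℤ → ℝ := (Set.Icc k l).indicator fun _ => a

lemma blockString_of_mem {a : ℝ} {k l j : ℤ} (h1 : k ≤ j) (h2 : j ≤ l) :
    blockString a k l j = a :=
  Set.indicator_of_mem (Set.mem_Icc.2 ⟨h1, h2⟩) _

lemma blockString_of_notMem {a : ℝ} {k l j : ℤ} (h : j < k ∨ l < j) :
    blockString a k l j = 0 :=
  Set.indicator_of_notMem (fun hj => by have := Set.mem_Icc.1 hj; omega) _

lemma support_blockString_finite (a : ℝ) (k l : ℤ) :
    (Function.support (blockString a k l)).Finite :=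
  (Set.finite_Icc k l).subset Set.support_indicator_subset

lemma blockString_mem {S : Set ℝ} {a : ℝ} (ha : a ∈ S) (h0 : (0 : ℝ) ∈ S) (k l j : ℤ) :
    blockString a k l j ∈ S := by
  unfold blockString Set.indicator
  split_ifs <;> assumption

/-- A parallel digit set conversion fixes the zero string. -/
lemma map_zero_of_local {β : ℝ} {S B : Set ℝ} {φ : (ℤ → ℝ) → ℤ → ℝ} {r t : ℕ}
    {Φ : (Fin (r + t + 1) → ℝ) → ℝ}
    (hΦ : ∀ (u : ℤ → ℝ) (j : ℤ), φ u j = Φ (fun i => u (j + (t : ℤ) - ((i : ℕ) : ℤ))))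
    (hφ : IsDigitSetConversion β S B φ) (h0 : (0 : ℝ) ∈ S) (j : ℤ) : φ (fun _ => 0) j = 0 := by
  by_contra hj
  refine Set.infinite_univ ((hφ.2 (fun _ => 0) (fun _ => h0) (by simp)).1.subset fun k _ => ?_)
  rw [Function.mem_support, local_congr hΦ (w := fun _ => 0) (k := j) fun _ _ _ => rfl]
  exact hj

/-- The image of a constant digit `a` under a parallel conversion into an integer alphabet is
congruent to `a` modulo `f(1)`. -/
lemma minpoly_eval_one_dvd_map_const_sub {β : ℝ} (hβint : IsIntegral ℤ β) (hβ : β ≠ 0)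
    {S B : Set ℝ} (hB : ∀ x ∈ B, ∃ k : ℤ, (k : ℝ) = x) {φ : (ℤ → ℝ) → ℤ → ℝ} {r t : ℕ}
    {Φ : (Fin (r + t + 1) → ℝ) → ℝ}
    (hΦ : ∀ (u : ℤ → ℝ) (j : ℤ), φ u j = Φ (fun i => u (j + (t : ℤ) - ((i : ℕ) : ℤ))))
    (hφ : IsDigitSetConversion β S B φ) (h0 : (0 : ℝ) ∈ S) (a c : ℤ) (ha : (a : ℝ) ∈ S)
    (hc : φ (fun _ => (a : ℝ)) 0 = c) : (minpoly ℤ β).eval 1 ∣ c - a := by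
  set u := blockString (a : ℝ) 0 (r + t)
  set w := blockString (a : ℝ) 1 (r + t)
  have hu : ∀ j, u j ∈ S := blockString_mem ha h0 _ _
  have hw : ∀ j, w j ∈ S := blockString_mem ha h0 _ _
  have hu0 : u 0 = a := blockString_of_mem le_rfl (by omega)
  have hw0 : w 0 = 0 := blockString_of_notMem (by omega)
  have huw : ∀ j, j ≠ 0 → u j = w j := by
    intro j hj
    by_cases h : 1 ≤ j ∧ j ≤ r + t
    · exact (blockString_of_mem (by omega) h.2).trans (blockString_of_mem h.1 h.2).symm
    · exact (blockString_of_notMem (by omega)).trans (blockString_of_notMem (by omega)).symm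
  have hsum := sum_window_sub hΦ hφ hu hw (support_blockString_finite _ _ _)
    (support_blockString_finite _ _ _) huw
  choose g hg using fun j => hB _ (hφ.1 u hu j)
  have hshift : ∀ j ∈ Finset.Icc (-(t : ℤ)) r, φ w j = φ u (j - 1) := by
    intro j hj
    rw [Finset.mem_Icc] at hj
    refine local_congr hΦ fun i hi hi' => ?_
    by_cases h : 1 ≤ j + i
    · exact (blockString_of_mem h (by omega)).trans
        (blockString_of_mem (by omega) (by omega)).symm
    · exact (blockString_of_notMem (by omega)).trans (blockString_of_notMem (by omega)).symm
  have hright : g r = c := by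
    have : φ u r = φ (fun _ => (a : ℝ)) 0 :=
      local_congr hΦ fun i hi hi' => blockString_of_mem (by omega) (by omega)
    exact_mod_cast (hg r).trans (this.trans hc)
  have hleft : g (-t - 1) = 0 := by
    have : φ u (-t - 1) = φ (fun _ => 0) 0 :=
      local_congr hΦ fun i hi hi' => blockString_of_notMem (by omega)
    exact_mod_cast (hg _).trans (this.trans (map_zero_of_local hΦ hφ h0 0))
  have htel : ∀ n : ℕ, ∑ j ∈ Finset.Icc (-(t : ℤ)) (-t + n), (g j - g (j - 1))
      = g (-t + n) - g (-t - 1) := by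
    intro n
    induction n with
    | zero => simp
    | succ n ih =>
      have hins : Finset.Icc (-(t : ℤ)) (-t + (n + 1 : ℕ))
          = insert (-(t : ℤ) + (n + 1 : ℕ)) (Finset.Icc (-(t : ℤ)) (-t + n)) := by
        ext x
        simp only [Finset.mem_Icc, Finset.mem_insert]
        omega
      rw [hins, Finset.sum_insert (by simp), ih]
      have : -(t : ℤ) + (n + 1 : ℕ) - 1 = -t + n := by omega
      rw [this]
      ring
  have key := minpoly_eval_one_dvd_sum_sub hβint hβ (Finset.Icc (-(t : ℤ)) r) t
    (fun j hj => (Finset.mem_Icc.1 hj).1) (fun j => g j - g (j - 1)) a (by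
      rw [hu0, hw0, sub_zero] at hsum
      rw [← hsum]
      refine Finset.sum_congr rfl fun j hj => ?_
      rw [hshift j hj, ← hg, ← hg]
      push_cast
      rfl)
  have htel' := htel (t + r)
  rw [show -(t : ℤ) + (t + r : ℕ) = r by omega, hright, hleft, sub_zero] at htel'
  rwa [htel'] at key

/-- Replacing the digit at the origin of a long block of `a` by `x` changes the image, inside the
window and relative to the image of the constant string `a`, by a total value of `x - a`. -/
lemma exists_window_sum_eq {β : ℝ} {S B : Set ℝ} {φ : (ℤ → ℝ) → ℤ → ℝ} {r t : ℕ}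
    {Φ : (Fin (r + t + 1) → ℝ) → ℝ}
    (hΦ : ∀ (u : ℤ → ℝ) (j : ℤ), φ u j = Φ (fun i => u (j + (t : ℤ) - ((i : ℕ) : ℤ))))
    (hφ : IsDigitSetConversion β S B φ) (h0 : (0 : ℝ) ∈ S) {a x : ℝ} (ha : a ∈ S) (hx : x ∈ S) :
    ∃ v : ℤ → ℝ, (∀ j, v j ∈ B) ∧
      ∑ j ∈ Finset.Icc (-(t : ℤ)) r, (v j - φ (fun _ => a) 0) * β ^ j = x - a := by
  set w := blockString a (-(r + t)) (r + t)
  have hw : ∀ j, w j ∈ S := blockString_mem ha h0 _ _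
  have hws : (Function.support w).Finite := support_blockString_finite _ _ _
  have hu : ∀ j, Function.update w 0 x j ∈ S := by
    intro j
    by_cases hj : j = 0
    · simpa [hj] using hx
    · simpa [hj] using hw j
  have hus : (Function.support (Function.update w 0 x)).Finite := by
    refine (hws.insert 0).subset fun j hj => ?_
    by_cases hj0 : j = 0
    · exact Or.inl hj0
    · exact Or.inr (by simpa [hj0] using hj)
  refine ⟨φ (Function.update w 0 x), hφ.1 _ hu, ?_⟩
  have hsum := sum_window_sub hΦ hφ hu hw hus hws fun j hj => Function.update_of_ne hj _ _
  rw [Function.update_self, show w 0 = a from blockString_of_mem (by omega) (by omega)] at hsum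
  rw [← hsum]
  refine Finset.sum_congr rfl fun j hj => ?_
  rw [Finset.mem_Icc] at hj
  rw [local_congr hΦ (u := w) (w := fun _ => a) (j := j) (k := 0) fun i hi hi' =>
    blockString_of_mem (by omega) (by omega)]

/-- If `β > 1` is a real algebraic integer with minimal polynomial `f`, and the alphabet
`{m, …, M}` of contiguous integers containing `0` and `1` allows parallel addition in
base `β`, then its cardinality `M - m + 1` is at least `|f(1)| + 2`. -/
theorem card_ge_abs_minpoly_eval_one_add_two_of_parallelAddition
    (β : ℝ) (hβint : IsIntegral ℤ β) (hβ : 1 < β)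
    (m M : ℤ) (hm : m ≤ 0) (hM : 0 < M)
    (h : ParallelAddition β (intAlphabet m M)) :
    |(minpoly ℤ β).eval 1| + 2 ≤ M - m + 1 := by
  obtain ⟨p, φ, Φ, ⟨r, t, rfl, hΦ⟩, hφ⟩ := h
  have h0A : (0 : ℝ) ∈ intAlphabet m M := ⟨0, ⟨hm, hM.le⟩, by simp⟩
  have hMA : (M : ℝ) ∈ intAlphabet m M := ⟨M, ⟨by omega, le_rfl⟩, rfl⟩
  have h0 : (0 : ℝ) ∈ intAlphabet m M + intAlphabet m M := by
    simpa using Set.add_mem_add h0A h0A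
  have ha : (M : ℝ) ∈ intAlphabet m M + intAlphabet m M := by
    simpa using Set.add_mem_add hMA h0A
  have h2 : (M : ℝ) + M ∈ intAlphabet m M + intAlphabet m M := Set.add_mem_add hMA hMA
  have hM' : (0 : ℝ) < M := by exact_mod_cast hM
  obtain ⟨c, ⟨hmc, hcM⟩, hc : (c : ℝ) = _⟩ := hφ.1 (fun _ => (M : ℝ)) (fun _ => ha) 0
  have hdvd := minpoly_eval_one_dvd_map_const_sub hβint (by positivity)
    (B := intAlphabet m M)
    (fun _ ⟨k, _, hk⟩ => ⟨k, hk⟩) hΦ hφ h0 M c ha hc.symm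
  have hc_ne_top : c ≠ M := by
    rintro rfl
    obtain ⟨v, hv, hsum⟩ := exists_window_sum_eq hΦ hφ h0 ha h2
    rw [← hc] at hsum
    have hle : ∑ j ∈ Finset.Icc (-(t : ℤ)) r, (v j - c) * β ^ j ≤ 0 := by
      refine Finset.sum_nonpos fun j _ => mul_nonpos_of_nonpos_of_nonneg ?_ (by positivity)
      obtain ⟨k, hk, hkv : (k : ℝ) = v j⟩ := hv j
      rw [← hkv, sub_nonpos]
      exact_mod_cast hk.2
    linarith
  have hc_ne_bot : c ≠ m := by
    rintro rfl
    obtain ⟨v, hv, hsum⟩ := exists_window_sum_eq hΦ hφ h0 ha h0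
    rw [← hc] at hsum
    have hle : 0 ≤ ∑ j ∈ Finset.Icc (-(t : ℤ)) r, (v j - c) * β ^ j := by
      refine Finset.sum_nonneg fun j _ => mul_nonneg ?_ (by positivity)
      obtain ⟨k, hk, hkv : (k : ℝ) = v j⟩ := hv j
      rw [← hkv, sub_nonneg]
      exact_mod_cast hk.1
    linarith
  have hle := Int.le_of_dvd (show 0 < M - c by omega) ((abs_dvd _ _).2 ((dvd_sub_comm).1 hdvd))
  omega
end

section
/- Let β > 1 be a real algebraic integer with minimal polynomial f(X) ∈ ℤ[X], and let D be a finite set of (not necessarily contiguous) integers containing 0 such that gcd of the elements of D is 1 and min D < 0 < max D. If addition on Fin_D(β) is computable in parallel, then #D ≥ |f(1)| + 2. -/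
open scoped Pointwise

open Polynomial in
/-- A vanishing integer Laurent polynomial in `β` has coefficient sum divisible by `f(1)`. -/
theorem minpoly_eval_one_dvd_finsum {β : ℝ} (hβint : IsIntegral ℤ β) (hβ : 1 < β)
    {w : ℤ → ℤ} (hw : w.support.Finite) (h0 : ∑ᶠ j, (w j : ℝ) * β ^ j = 0) :
    (minpoly ℤ β).eval 1 ∣ ∑ᶠ j, w j := by
  have hβ0 : β ≠ 0 := by positivity
  obtain ⟨l, hl⟩ := hw.bddBelow
  set P : ℤ[X] := ∑ j ∈ hw.toFinset, C (w j) * X ^ (j - l).toNat with hP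
  have hval : ∑ᶠ j, (w j : ℝ) * β ^ j = ∑ j ∈ hw.toFinset, (w j : ℝ) * β ^ j := by
    apply finsum_eq_sum_of_support_subset
    intro j hj
    have : w j ≠ 0 := by rintro h; simp [h] at hj
    simpa using this
  have hroot : aeval β P = 0 := by
    have : aeval β P = β ^ (-l) * ∑ j ∈ hw.toFinset, (w j : ℝ) * β ^ j := by
      rw [hP, map_sum, Finset.mul_sum]
      refine Finset.sum_congr rfl fun j hj => ?_
      have hlj : l ≤ j := hl (by simpa using hj)
      have hpow : β ^ (j - l).toNat = β ^ (-l) * β ^ j := by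
        rw [← zpow_natCast, Int.toNat_of_nonneg (by omega), ← zpow_add₀ hβ0]
        congr 1; ring
      simp only [map_mul, map_pow, aeval_X, aeval_C, hpow]
      simp only [algebraMap_int_eq, eq_intCast]
      ring
    rw [this, ← hval, h0, mul_zero]
  obtain ⟨q, hq⟩ := minpoly.isIntegrallyClosed_dvd hβint hroot
  have hsum : ∑ᶠ j, w j = P.eval 1 := by
    rw [finsum_eq_sum_of_support_subset w (s := hw.toFinset) (by simp), hP, eval_finsetSum]
    simp
  rw [hsum, hq, eval_mul]
  exact dvd_mul_right _ _

theorem support_mul_zpow_finite {β : ℝ} {u : ℤ → ℝ} (hu : u.support.Finite) :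
    (Function.support fun j : ℤ => u j * β ^ j).Finite :=
  hu.subset fun j hj h => hj (by simp [h])

theorem minpoly_eval_one_dvd_finsum_sub {β : ℝ} (hβint : IsIntegral ℤ β) (hβ : 1 < β)
    {u v : ℤ → ℤ} (hu : u.support.Finite) (hv : v.support.Finite)
    (h : seqValue β (fun j => u j) = seqValue β (fun j => v j)) :
    (minpoly ℤ β).eval 1 ∣ ∑ᶠ j, u j - ∑ᶠ j, v j := by
  have hu' : (Function.support fun j => (u j : ℝ)).Finite := hu.subset fun j hj => by simpa using hj
  have hv' : (Function.support fun j => (v j : ℝ)).Finite := hv.subset fun j hj => by simpa using hj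
  rw [← finsum_sub_distrib hu hv]
  refine minpoly_eval_one_dvd_finsum hβint hβ
    ((hu.union hv).subset (Function.support_sub u v)) ?_
  have := finsum_sub_distrib (support_mul_zpow_finite (β := β) hu')
    (support_mul_zpow_finite (β := β) hv')
  unfold seqValue at h
  rw [h, sub_self] at this
  rw [← this]
  exact finsum_congr fun j => by push_cast; ring

/-- Duplicating the entry at position `r` adds that entry to the sum. -/
theorem finsum_duplicate {V V' : ℤ → ℤ} (hV : V.support.Finite) (r : ℤ)
    (hle : ∀ j ≤ r, V' j = V j) (hgt : ∀ j ≥ r, V' (j + 1) = V j) :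
    ∑ᶠ j, V' j = ∑ᶠ j, V j + V r := by
  classical
  have h₁ : (Function.support ((Set.Iic r).indicator V)).Finite :=
    hV.subset (by simp)
  have h₂ : (Function.support ((Set.Ici r).indicator V)).Finite :=
    hV.subset (by simp)
  have h₃ : (Function.support (Pi.single r (V r) : ℤ → ℤ)).Finite :=
    (Set.finite_singleton r).subset (Pi.support_single_subset)
  have h₂' : (Function.support fun j => (Set.Ici r).indicator V (Equiv.subRight 1 j)).Finite :=
    h₂.preimage (f := Equiv.subRight (1 : ℤ)) (Equiv.injective _).injOn
  have e₃ : ∑ᶠ j, (Pi.single r (V r) : ℤ → ℤ) j = V r := by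
    rw [finsum_eq_single _ r fun j hj => by simp [hj], Pi.single_eq_same]
  calc ∑ᶠ j, V' j
      = ∑ᶠ j, ((Set.Iic r).indicator V j + (Set.Ici r).indicator V (Equiv.subRight 1 j)) := by
        refine finsum_congr fun j => ?_
        rcases le_or_gt j r with hj | hj
        · have : ¬ r ≤ j - 1 := by omega
          simp [hj, this, hle j hj]
        · have h := hgt (j - 1) (by omega)
          have : r ≤ j - 1 := by omega
          rw [sub_add_cancel] at h
          simp [hj, this, h]
    _ = ∑ᶠ j, (Set.Iic r).indicator V j + ∑ᶠ j, (Set.Ici r).indicator V j := by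
        rw [finsum_add_distrib h₁ h₂', finsum_comp_equiv]
    _ = ∑ᶠ j, (V j + (Pi.single r (V r) : ℤ → ℤ) j) := by
        rw [← finsum_add_distrib h₁ h₂]
        refine finsum_congr fun j => ?_
        rcases lt_trichotomy j r with hj | rfl | hj
        · simp [hj.le, hj.ne, not_le.mpr hj]
        · simp
        · simp [hj.le, hj.ne', not_le.mpr hj]
    _ = ∑ᶠ j, V j + V r := by rw [finsum_add_distrib hV h₃, e₃]

/-- The string with the letter `b` at the positions `0, …, n - 1` and zero elsewhere. -/
noncomputable def block {R : Type*} [Zero R] (b : R) (n : ℕ) : ℤ → R :=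
  (Set.Ico (0 : ℤ) n).indicator fun _ => b

theorem block_support_finite {R : Type*} [Zero R] (b : R) (n : ℕ) :
    (Function.support (block b n)).Finite :=
  (Set.finite_Ico (0 : ℤ) n).subset Set.support_indicator_subset

theorem finsum_block (b : ℤ) (n : ℕ) : ∑ᶠ j, block b n j = n * b := by
  rw [finsum_eq_sum_of_support_subset (s := Finset.Ico (0 : ℤ) n) _
    (by simp [block]),
    Finset.sum_congr rfl (g := fun _ => b)
    (fun j hj => Set.indicator_of_mem (by simpa using hj) _)]
  simp

section Conversion

variable {β : ℝ} {A B : Set ℝ} {p : ℕ} {φ : (ℤ → ℝ) → ℤ → ℝ} {Φ : (Fin p → ℝ) → ℝ}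

/-- A local conversion into integer digits maps constant strings to constant strings,
preserving the letter modulo `f(1)`. -/
theorem minpoly_eval_one_dvd_of_const (hβint : IsIntegral ℤ β) (hβ : 1 < β)
    (hloc : IsLocallyRealized p φ Φ) (hconv : IsDigitSetConversion β A B φ)
    (hB : ∀ x ∈ B, ∃ k : ℤ, (k : ℝ) = x) (h0 : (0 : ℝ) ∈ A)
    {b y : ℤ} (hb : (b : ℝ) ∈ A) (hy : Φ (fun _ => (b : ℝ)) = y) :
    (minpoly ℤ β).eval 1 ∣ b - y := by
  obtain ⟨r, t, rfl, hφ⟩ := hloc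
  have hA : ∀ n j, block (b : ℝ) n j ∈ A := fun n j => by
    unfold block
    by_cases hj : j ∈ Set.Ico (0 : ℤ) n
    · rwa [Set.indicator_of_mem hj]
    · rwa [Set.indicator_of_notMem hj]
  choose V hV using fun n j => hB _ (hconv.1 (block (b : ℝ) n) (hA n) j)
  have hVfin : ∀ n, (V n).support.Finite := fun n =>
    (hconv.2 _ (hA n) (block_support_finite _ _)).1.subset fun j hj => by
      simpa [← hV] using hj
  have hdvd : ∀ n : ℕ, (minpoly ℤ β).eval 1 ∣ n * b - ∑ᶠ j, V n j := fun n => by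
    rw [← finsum_block]
    refine minpoly_eval_one_dvd_finsum_sub hβint hβ (block_support_finite _ _) (hVfin n) ?_
    have hcast : (fun j => ((block b n j : ℤ) : ℝ)) = block (b : ℝ) n := by
      ext j
      by_cases hj : j ∈ Set.Ico (0 : ℤ) n <;> simp only [block, Set.indicator, hj] <;> simp
    simp only [hV, hcast]
    exact (hconv.2 _ (hA n) (block_support_finite _ _)).2.symm
  set n := r + t + 1 with hn
  have hle : ∀ j ≤ (r : ℤ), V (n + 1) j = V n j := fun j hj => by
    have : φ (block (b : ℝ) (n + 1)) j = φ (block (b : ℝ) n) j := by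
      rw [hφ, hφ]
      congr 1
      ext i
      simp only [block, Set.indicator, Set.mem_Ico]
      congr 1
      apply propext
      omega
    rw [← hV, ← hV] at this
    exact_mod_cast this
  have hgt : ∀ j ≥ (r : ℤ), V (n + 1) (j + 1) = V n j := fun j hj => by
    have : φ (block (b : ℝ) (n + 1)) (j + 1) = φ (block (b : ℝ) n) j := by
      rw [hφ, hφ]
      congr 1
      ext i
      simp only [block, Set.indicator, Set.mem_Ico]
      congr 1
      apply propext
      omega
    rw [← hV, ← hV] at this
    exact_mod_cast this
  have hmid : V n r = y := by
    have : φ (block (b : ℝ) n) r = y := by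
      rw [hφ, ← hy]
      congr 1
      ext i
      apply Set.indicator_of_mem
      simp only [Set.mem_Ico]
      omega
    rw [← hV] at this
    exact_mod_cast this
  have hdiff := dvd_sub (hdvd (n + 1)) (hdvd n)
  rw [finsum_duplicate (hVfin n) r hle hgt, hmid] at hdiff
  have hsub : b - y = ((n + 1 : ℕ) : ℤ) * b - (∑ᶠ j, V n j + y) - (n * b - ∑ᶠ j, V n j) := by
    push_cast
    ring
  rwa [hsub]

/-- In base `β > 1`, a constant string whose letter is not extremal in the input alphabet is not
mapped to the extremal letter of the output alphabet; the maximum is the case `s = 1`, the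
minimum the case `s = -1`. -/
theorem const_ne_extremal (hβ : 1 < β)
    (hloc : IsLocallyRealized p φ Φ) (hconv : IsDigitSetConversion β A B φ)
    (h0 : (0 : ℝ) ∈ A) {b c s y K : ℝ} (hb : b ∈ A) (hc : c ∈ A) (hbc : s * b < s * c)
    (hy : ∀ x ∈ B, s * x ≤ s * y) (hK : ∀ x ∈ B, |s * x| ≤ K) :
    Φ (fun _ => b) ≠ y := by
  intro hby
  obtain ⟨r, t, rfl, hφ⟩ := hloc
  have hβ0 : 0 < β := by linarith
  set M := ∑ j ∈ Finset.Ico (-(t : ℤ)) r, 2 * K * β ^ j with hM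
  obtain ⟨k, hk⟩ := exists_nat_gt (M / (s * c - s * b))
  rw [div_lt_iff₀ (by linarith)] at hk
  set u' := block b (k + r + t) with hu'
  set u : ℤ → ℝ := fun j => u' j + block (c - b) k j with hu
  have hu'A : ∀ j, u' j ∈ A := fun j => by
    by_cases hj : j ∈ Set.Ico (0 : ℤ) (k + r + t : ℕ)
    · rwa [hu', block, Set.indicator_of_mem hj]
    · rwa [hu', block, Set.indicator_of_notMem hj]
  have huA : ∀ j, u j ∈ A := fun j => by
    by_cases hj : j ∈ Set.Ico (0 : ℤ) k
    · have hj' : j ∈ Set.Ico (0 : ℤ) (k + r + t : ℕ) := by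
        simp only [Set.mem_Ico] at hj ⊢; omega
      simp only [hu, hu', block, Set.indicator_of_mem hj, Set.indicator_of_mem hj']
      simpa using hc
    · have h := hu'A j
      simpa only [hu, block, Set.indicator_of_notMem hj, add_zero] using h
  have hu'fin : u'.support.Finite := block_support_finite _ _
  have hdfin : (Function.support (block (c - b) k)).Finite := block_support_finite _ _
  have hufin : u.support.Finite := (hu'fin.union hdfin).subset (Function.support_add _ _)
  obtain ⟨hvfin, hv⟩ := hconv.2 u huA hufin
  obtain ⟨hv'fin, hv'⟩ := hconv.2 u' hu'A hu'fin
  have hin : seqValue β u - seqValue β u' = ∑ j ∈ Finset.Ico (0 : ℤ) k, (c - b) * β ^ j := by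
    have : seqValue β u = seqValue β u' + seqValue β (block (c - b) k) := by
      unfold seqValue
      rw [← finsum_add_distrib (support_mul_zpow_finite hu'fin) (support_mul_zpow_finite hdfin)]
      exact finsum_congr fun j => by simp only [hu]; ring
    rw [this, add_sub_cancel_left, seqValue, finsum_eq_sum_of_support_subset
      (s := Finset.Ico (0 : ℤ) k)]
    · refine Finset.sum_congr rfl fun j hj => ?_
      rw [block, Set.indicator_of_mem (by simpa using hj)]
    · intro j hj
      by_contra h
      exact hj (by simp only [block]; rw [Set.indicator_of_notMem (by simpa using h), zero_mul])
  have hagree : ∀ j, j < -(t : ℤ) ∨ (k : ℤ) + r ≤ j → φ u j = φ u' j := fun j hj => by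
    rw [hφ, hφ]
    congr 1
    ext i
    simp only [hu, block]
    rw [Set.indicator_of_notMem, add_zero]
    simp only [Set.mem_Ico]
    omega
  have hmid : ∀ j : ℤ, r ≤ j → j < (k : ℤ) + r → φ u' j = y := fun j h₁ h₂ => by
    rw [hφ, ← hby]
    congr 1
    ext i
    apply Set.indicator_of_mem
    simp only [Set.mem_Ico]
    omega
  have hout : seqValue β (φ u) - seqValue β (φ u') =
      ∑ j ∈ Finset.Ico (-(t : ℤ)) (k + r), (φ u j - φ u' j) * β ^ j := by
    unfold seqValue
    rw [← finsum_sub_distrib (support_mul_zpow_finite hvfin) (support_mul_zpow_finite hv'fin),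
      finsum_eq_sum_of_support_subset (s := Finset.Ico (-(t : ℤ)) (k + r))]
    · exact Finset.sum_congr rfl fun j _ => by ring
    · intro j hj
      by_contra h
      refine hj ?_
      simp only [Finset.coe_Ico, Set.mem_Ico] at h
      beta_reduce
      rw [hagree j (by omega), sub_self]
  have hlow : (k : ℝ) * (s * c - s * b) ≤ s * ∑ j ∈ Finset.Ico (0 : ℤ) k, (c - b) * β ^ j := by
    rw [Finset.mul_sum]
    calc (k : ℝ) * (s * c - s * b) = ∑ j ∈ Finset.Ico (0 : ℤ) k, (s * c - s * b) := by simp [mul_sub]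
      _ ≤ _ := Finset.sum_le_sum fun j hj => by
        have h1 : 1 ≤ β ^ j := one_le_zpow₀ hβ.le (by simpa using (Finset.mem_Ico.mp hj).1)
        nlinarith
  have hup : s * ∑ j ∈ Finset.Ico (-(t : ℤ)) (k + r), (φ u j - φ u' j) * β ^ j ≤ M := by
    rw [← Finset.Ico_union_Ico_eq_Ico (show -(t : ℤ) ≤ r by omega) (show (r : ℤ) ≤ k + r by omega),
      Finset.sum_union (Finset.Ico_disjoint_Ico_consecutive _ _ _), mul_add, Finset.mul_sum, Finset.mul_sum, hM]
    have hA₁ : ∑ j ∈ Finset.Ico (-(t : ℤ)) r, s * ((φ u j - φ u' j) * β ^ j) ≤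
        ∑ j ∈ Finset.Ico (-(t : ℤ)) r, 2 * K * β ^ j := Finset.sum_le_sum fun j _ => by
      have h₁ := (abs_le.mp (hK _ (hconv.1 u huA j))).2
      have h₂ := (abs_le.mp (hK _ (hconv.1 u' hu'A j))).1
      rw [← mul_assoc]
      exact mul_le_mul_of_nonneg_right (by linarith) (zpow_pos hβ0 j).le
    have hA₂ : ∑ j ∈ Finset.Ico (r : ℤ) (k + r), s * ((φ u j - φ u' j) * β ^ j) ≤ 0 :=
      Finset.sum_nonpos fun j hj => by
        rw [Finset.mem_Ico] at hj
        have h₁ := hy _ (hconv.1 u huA j)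
        rw [hmid j hj.1 hj.2, ← mul_assoc]
        exact mul_nonpos_of_nonpos_of_nonneg (by linarith) (zpow_pos hβ0 j).le
    linarith
  rw [hv, hv'] at hout
  rw [← hin, hout] at hlow
  linarith

end Conversion

/-- A finite set of integers with gcd `1` that is closed under addition modulo `m ≠ 0` meets every
residue class modulo `m`. -/
theorem exists_mem_dvd_sub_of_gcd_eq_one {D : Finset ℤ} (hD0 : (0 : ℤ) ∈ D)
    (hgcd : D.gcd id = 1) {m : ℤ} (hm : m ≠ 0)
    (hadd : ∀ a ∈ D, ∀ b ∈ D, ∃ d ∈ D, m ∣ a + b - d) (x : ℤ) : ∃ d ∈ D, m ∣ x - d := by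
  let S : AddSubmonoid ℤ :=
    { carrier := {x | ∃ d ∈ D, m ∣ x - d}
      zero_mem' := ⟨0, hD0, by simp⟩
      add_mem' := by
        rintro x y ⟨d, hd, hxd⟩ ⟨e, he, hye⟩
        obtain ⟨g, hg, hdg⟩ := hadd d hd e he
        refine ⟨g, hg, ?_⟩
        rw [show x + y - g = x - d + (y - e) + (d + e - g) by ring]
        exact dvd_add (dvd_add hxd hye) hdg }
  let T : AddSubgroup ℤ :=
    { S with
      neg_mem' := by
        intro x hx
        obtain ⟨d, hd, hxd⟩ := S.nsmul_mem hx (m.natAbs - 1)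
        refine ⟨d, hd, ?_⟩
        have hpos : 1 ≤ m.natAbs := Int.natAbs_pos.mpr hm
        have hdvd : m ∣ (m.natAbs : ℤ) * x := (Int.dvd_natAbs.mpr dvd_rfl).mul_right x
        have hneg : -x - d = (m.natAbs - 1) • x - d - (m.natAbs : ℤ) * x := by
          rw [nsmul_eq_mul, Nat.cast_sub hpos, Nat.cast_one]
          ring
        exact hneg ▸ dvd_sub hxd hdvd }
  obtain ⟨g, hg⟩ := Int.subgroup_cyclic T
  have hgD : ∀ d ∈ D, g ∣ d := fun d hd => by
    have : d ∈ T := ⟨d, hd, by simp⟩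
    rw [hg, AddSubgroup.mem_closure_singleton] at this
    obtain ⟨n, hn⟩ := this
    exact ⟨n, by rw [← hn, zsmul_eq_mul, mul_comm]; simp⟩
  have hg1 : g ∣ 1 := hgcd ▸ Finset.dvd_gcd hgD
  have hx : x ∈ T := by
    obtain ⟨q, hq⟩ := hg1.mul_right x
    rw [hg, AddSubgroup.mem_closure_singleton]
    exact ⟨q, by rw [zsmul_eq_mul, mul_comm]; simpa using hq.symm⟩
  exact hx

theorem natAbs_le_card_of_forall_exists_dvd_sub {E : Finset ℤ} {m : ℤ}
    (h : ∀ x : ℤ, ∃ d ∈ E, m ∣ x - d) : m.natAbs ≤ E.card := by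
  choose g hgE hg using h
  rw [← Finset.card_range m.natAbs]
  refine Finset.card_le_card_of_injOn (fun k : ℕ => g k) (fun k _ => hgE k) fun a ha b hb hab => ?_
  simp only [Finset.coe_range, Set.mem_Iio] at ha hb
  have hdvd : m ∣ (a : ℤ) - b := by
    have hab' : g a = g b := hab
    have hsub : (a : ℤ) - b = (a - g a) - (b - g b) := by rw [hab']; ring
    exact hsub ▸ dvd_sub (hg a) (hg b)
  have := Int.eq_zero_of_abs_lt_dvd (Int.natAbs_dvd.mpr hdvd)
    (abs_lt.mpr ⟨by omega, by omega⟩)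
  omega

theorem minpoly_eval_one_ne_zero {β : ℝ} (hβint : IsIntegral ℤ β) (hβ : 1 < β) :
    (minpoly ℤ β).eval 1 ≠ 0 := by
  intro h
  have hirr := minpoly.irreducible hβint
  obtain ⟨q, hq⟩ := Polynomial.dvd_iff_isRoot.mpr h
  have hunit := (hirr.isUnit_or_isUnit hq).resolve_left (Polynomial.not_isUnit_X_sub_C 1)
  have h0 := minpoly.aeval ℤ β
  rw [hq, map_mul] at h0
  rcases mul_eq_zero.mp h0 with h1 | h1
  · simp at h1
    linarith
  · exact (hunit.map (Polynomial.aeval β)).ne_zero h1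

/-- If `β > 1` is a real algebraic integer with minimal polynomial `f`, and `D` is a
finite set of (not necessarily contiguous) integers containing `0`, whose elements have
gcd equal to `1` and with `min D < 0 < max D`, and addition on `Fin_D(β)` is computable
in parallel, then `#D ≥ |f(1)| + 2`. -/
theorem card_ge_abs_minpoly_eval_one_add_two_of_gcd_one
    (β : ℝ) (hβint : IsIntegral ℤ β) (hβ : 1 < β)
    (D : Finset ℤ) (hD0 : (0 : ℤ) ∈ D)
    (hgcd : D.gcd id = 1)
    (hneg : ∃ d ∈ D, d < 0) (hpos : ∃ d ∈ D, 0 < d)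
    (A : Set ℝ) (hA : A = (fun k : ℤ => (k : ℝ)) '' (D : Set ℤ))
    (h : ParallelAddition β A) :
    |(minpoly ℤ β).eval 1| + 2 ≤ (D.card : ℤ) := by
  classical
  obtain ⟨p, φ, Φ, hloc, hconv⟩ := h
  have hmemA : ∀ d : ℤ, (d : ℝ) ∈ A ↔ d ∈ D := fun d => by simp [hA]
  have hAint : ∀ x ∈ A, ∃ k : ℤ, (k : ℝ) = x := by
    rintro x hx
    rw [hA] at hx
    exact hx.imp fun k hk => hk.2
  have h0A : (0 : ℝ) ∈ A := by exact_mod_cast (hmemA 0).mpr hD0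
  have hsum : ∀ a ∈ D, ∀ b ∈ D, ((a + b : ℤ) : ℝ) ∈ A + A := fun a ha b hb => by
    push_cast
    exact Set.add_mem_add ((hmemA a).mpr ha) ((hmemA b).mpr hb)
  have h0AA : (0 : ℝ) ∈ A + A := by simpa using hsum 0 hD0 0 hD0
  have hconst : ∀ b : ℤ, (b : ℝ) ∈ A + A → ∃ y ∈ D, Φ (fun _ => (b : ℝ)) = y ∧
      (minpoly ℤ β).eval 1 ∣ b - y := fun b hb => by
    have hΦ : Φ (fun _ => (b : ℝ)) ∈ A := by
      have := hconv.1 (fun _ => (b : ℝ)) (fun _ => hb) 0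
      obtain ⟨r, t, -, hφ⟩ := hloc
      rwa [hφ] at this
    obtain ⟨y, hy⟩ := hAint _ hΦ
    exact ⟨y, (hmemA y).mp (hy ▸ hΦ), hy.symm,
      minpoly_eval_one_dvd_of_const hβint hβ hloc hconv hAint h0AA hb hy.symm⟩
  have hres := exists_mem_dvd_sub_of_gcd_eq_one hD0 hgcd (minpoly_eval_one_ne_zero hβint hβ)
    fun a ha b hb => (hconst (a + b) (hsum a ha b hb)).imp fun y hy => ⟨hy.1, hy.2.2⟩
  have hDne : D.Nonempty := ⟨0, hD0⟩
  set Λ := D.max' hDne with hΛ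
  set l := D.min' hDne with hl
  have hΛD : Λ ∈ D := D.max'_mem hDne
  have hlD : l ∈ D := D.min'_mem hDne
  have hΛpos : 0 < Λ := hpos.elim fun d hd => hd.2.trans_le (D.le_max' d hd.1)
  have hlneg : l < 0 := hneg.elim fun d hd => (D.min'_le d hd.1).trans_lt hd.2
  have hbound : ∀ x ∈ A, (l : ℝ) ≤ x ∧ x ≤ Λ := fun x hx => by
    obtain ⟨k, rfl⟩ := hAint x hx
    have hk := (hmemA k).mp hx
    exact ⟨by exact_mod_cast D.min'_le k hk, by exact_mod_cast D.le_max' k hk⟩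
  have hΛR : (0 : ℝ) < Λ := by exact_mod_cast hΛpos
  have hlR : (l : ℝ) < 0 := by exact_mod_cast hlneg
  have hinner : ∀ x : ℤ, ∃ d ∈ (D.erase l).erase Λ, (minpoly ℤ β).eval 1 ∣ x - d := fun x => by
    obtain ⟨d, hd, hxd⟩ := hres x
    have hdAA : (d : ℝ) ∈ A + A := by simpa using hsum d hd 0 hD0
    obtain ⟨hld, hdΛ⟩ := hbound d ((hmemA d).mpr hd)
    obtain ⟨y, hyD, hy, hdy⟩ := hconst d hdAA
    have hyΛ : y ≠ Λ := by
      rintro rfl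
      refine const_ne_extremal (s := 1) (K := Λ - l) hβ hloc hconv h0AA hdAA
        (hsum _ hΛD _ hΛD) ?_ (fun x hx => ?_) (fun x hx => ?_) hy
      · push_cast; linarith
      · linarith [hbound x hx]
      · rw [one_mul, abs_le]
        constructor <;> linarith [hbound x hx]
    have hyl : y ≠ l := by
      rintro rfl
      refine const_ne_extremal (s := -1) (K := Λ - l) hβ hloc hconv h0AA hdAA
        (hsum _ hlD _ hlD) ?_ (fun x hx => ?_) (fun x hx => ?_) hy
      · push_cast; linarith
      · linarith [hbound x hx]
      · rw [neg_one_mul, abs_neg, abs_le]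
        constructor <;> linarith [hbound x hx]
    refine ⟨y, by simp [hyΛ, hyl, hyD], ?_⟩
    rw [show x - y = x - d + (d - y) by ring]
    exact dvd_add hxd hdy
  have hcard := natAbs_le_card_of_forall_exists_dvd_sub hinner
  have hΛmem : Λ ∈ D.erase l := Finset.mem_erase.mpr ⟨by omega, hΛD⟩
  have h₁ := Finset.card_erase_add_one hlD
  have h₂ := Finset.card_erase_add_one hΛmem
  rw [Int.abs_eq_natAbs]
  omega
end

section
/- Let a ∈ ℕ with a ≥ 3, and let β > 1 be the larger root of X² − aX + 1 (so β² = aβ − 1). Then every alphabet A of contiguous integers containing 0 of cardinality a allows parallel addition on Fin_A(β); moreover, this cardinality is minimal: no alphabet of contiguous integers containing 0 and 1 of cardinality less than a allows parallel addition on Fin_A(β). -/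
open scoped Pointwise

/-- `φ` commutes with shifts and `φ u j` depends only on the digits of `u` at distance at
most `R` from `j`. -/
def HasRadius (R : ℕ) (φ : (ℤ → ℝ) → ℤ → ℝ) : Prop :=
  ∀ (u v : ℤ → ℝ) (j k : ℤ), (∀ i : ℤ, -(R : ℤ) ≤ i → i ≤ R → u (j + i) = v (k + i)) →
    φ u j = φ v k

lemma IsLocallyRealized.hasRadius {p : ℕ} {φ : (ℤ → ℝ) → ℤ → ℝ} {Φ : (Fin p → ℝ) → ℝ}
    (h : IsLocallyRealized p φ Φ) : ∃ R, HasRadius R φ := by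
  obtain ⟨r, t, hp, h⟩ := h
  refine ⟨max r t, fun u v j k huv => ?_⟩
  rw [h, h]
  congr 1
  funext i
  have hi := i.isLt
  rw [add_sub_assoc, add_sub_assoc]
  apply huv <;> omega

lemma HasRadius.isLocallyRealized {R : ℕ} {φ : (ℤ → ℝ) → ℤ → ℝ} (h : HasRadius R φ) :
    ∃ (p : ℕ) (Φ : (Fin p → ℝ) → ℝ), IsLocallyRealized p φ Φ := by
  refine ⟨R + R + 1, fun w => φ (fun i => w (Fin.ofNat _ (R - i).toNat)) 0,
    R, R, rfl, fun u j => h _ _ _ _ fun i hi hi' => ?_⟩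
  have hlt : (R - (0 + i)).toNat < R + R + 1 := by omega
  simp only [Fin.val_ofNat, Nat.mod_eq_of_lt hlt]
  congr 1
  omega

lemma HasRadius.comp {R S : ℕ} {φ ψ : (ℤ → ℝ) → ℤ → ℝ} (hψ : HasRadius S ψ)
    (hφ : HasRadius R φ) : HasRadius (R + S) (ψ ∘ φ) := by
  refine fun u v j k huv => hψ _ _ _ _ fun i hi hi' => hφ _ _ _ _ fun l hl hl' => ?_
  rw [add_assoc, add_assoc]
  apply huv <;> push_cast <;> omega

lemma parallelConversion_iff {β : ℝ} {A B : Set ℝ} :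
    ParallelConversion β A B ↔ ∃ R φ, HasRadius R φ ∧ IsDigitSetConversion β A B φ := by
  constructor
  · rintro ⟨p, φ, Φ, h, hc⟩
    obtain ⟨R, hR⟩ := h.hasRadius
    exact ⟨R, φ, hR, hc⟩
  · rintro ⟨R, φ, h, hc⟩
    obtain ⟨p, Φ, hp⟩ := h.isLocallyRealized
    exact ⟨p, φ, Φ, hp, hc⟩

lemma ParallelConversion.refl (β : ℝ) (A : Set ℝ) : ParallelConversion β A A :=
  parallelConversion_iff.2 ⟨0, id, fun u v j k h => by simpa using h 0 (by simp) (by simp),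
    fun _ hu => hu, fun _ _ hf => ⟨hf, rfl⟩⟩

lemma ParallelConversion.trans {β : ℝ} {A B C : Set ℝ} (h₁ : ParallelConversion β A B)
    (h₂ : ParallelConversion β B C) : ParallelConversion β A C := by
  obtain ⟨R, φ, hφ, hA, hv⟩ := parallelConversion_iff.1 h₁
  obtain ⟨S, ψ, hψ, hB, hw⟩ := parallelConversion_iff.1 h₂
  refine parallelConversion_iff.2 ⟨R + S, ψ ∘ φ, hψ.comp hφ, fun u hu => hB _ (hA u hu),
    fun u hu hf => ?_⟩
  obtain ⟨h1, h2⟩ := hv u hu hf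
  obtain ⟨h3, h4⟩ := hw _ (hA u hu) h1
  exact ⟨h3, h4.trans h2⟩

lemma seqValue_neg (β : ℝ) (u : ℤ → ℝ) : seqValue β (-u) = -seqValue β u := by
  simp [seqValue, finsum_neg_distrib]

lemma ParallelConversion.neg {β : ℝ} {A B : Set ℝ} (h : ParallelConversion β A B) :
    ParallelConversion β (-A) (-B) := by
  obtain ⟨R, φ, hφ, hA, hv⟩ := parallelConversion_iff.1 h
  refine parallelConversion_iff.2 ⟨R, fun u => -φ (-u), fun u v j k huv => ?_, fun u hu j => ?_,
    fun u hu hf => ?_⟩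
  · simp only [Pi.neg_apply]
    congr 1
    exact hφ _ _ _ _ fun i hi hi' => by simp [huv i hi hi']
  · have := hA (-u) (fun j => by simpa using hu j) j
    simpa using this
  · obtain ⟨h1, h2⟩ := hv (-u) (fun j => by simpa using hu j) (by rwa [Function.support_neg])
    refine ⟨by rwa [Function.support_neg], ?_⟩
    rw [seqValue_neg, h2, seqValue_neg, neg_neg]

lemma neg_intAlphabet (m M : ℤ) : -intAlphabet m M = intAlphabet (-M) (-m) := by
  ext x
  simp only [intAlphabet, Set.mem_neg, Set.mem_image, Set.mem_Icc]
  constructor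
  · rintro ⟨k, hk, h⟩
    exact ⟨-k, by omega, by push_cast; linarith⟩
  · rintro ⟨k, hk, h⟩
    exact ⟨-k, by omega, by push_cast; linarith⟩

lemma intAlphabet_add {m M : ℤ} (h : m ≤ M) :
    intAlphabet m M + intAlphabet m M = intAlphabet (2 * m) (2 * M) := by
  ext x
  simp only [intAlphabet, Set.mem_add, Set.mem_image, Set.mem_Icc]
  constructor
  · rintro ⟨_, ⟨k, hk, rfl⟩, _, ⟨l, hl, rfl⟩, rfl⟩
    exact ⟨k + l, by omega, by push_cast; rfl⟩
  · rintro ⟨k, hk, rfl⟩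
    by_cases hkM : k ≤ m + M
    · exact ⟨_, ⟨m, by omega, rfl⟩, _, ⟨k - m, by omega, rfl⟩, by push_cast; ring⟩
    · exact ⟨_, ⟨M, by omega, rfl⟩, _, ⟨k - M, by omega, rfl⟩, by push_cast; ring⟩

/-- Position `j` surely has to emit a carry when the digits above `M` are reduced. -/
def PrimaryCarry (M : ℤ) (x : ℤ → ℤ) (j : ℤ) : Prop :=
  M + 1 ≤ x j ∨ M ≤ x j ∧ (M ≤ x (j + 1) ∨ M ≤ x (j - 1))

/-- Position `j` emits a carry when the digits above `M` are reduced. -/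
def Carry (M : ℤ) (x : ℤ → ℤ) (j : ℤ) : Prop :=
  PrimaryCarry M x j ∨
    M - 1 ≤ x j ∧ PrimaryCarry M x (j + 1) ∧ PrimaryCarry M x (j - 1)

open Classical in
/-- The number, `0` or `1`, of multiples of `X² - aX + 1` that get added around position `j`. -/
noncomputable def carry (M : ℤ) (x : ℤ → ℤ) (j : ℤ) : ℤ := if Carry M x j then 1 else 0

/-- One round of elimination of the greatest digit. -/
noncomputable def eliminate (a M : ℤ) (u : ℤ → ℝ) (j : ℤ) : ℝ :=
  u j + ((-a * carry M (fun i => ⌊u i⌋) j + carry M (fun i => ⌊u i⌋) (j + 1)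
    + carry M (fun i => ⌊u i⌋) (j - 1) : ℤ) : ℝ)

lemma carry_congr {M : ℤ} {x y : ℤ → ℤ} {j k : ℤ}
    (h : ∀ i : ℤ, -2 ≤ i → i ≤ 2 → x (j + i) = y (k + i)) : carry M x j = carry M y k := by
  have h0 : x j = y k := by simpa using h 0 (by simp) (by simp)
  have h1 := h 1 (by simp) (by simp)
  have h2 := h 2 (by simp) (by simp)
  have h3 := h (-1) (by simp) (by simp)
  have h4 := h (-2) (by simp) (by simp)
  simp only [carry, Carry, PrimaryCarry, sub_eq_add_neg, add_assoc, Int.reduceAdd, Int.reduceNeg,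
    add_zero, h0, h1, h2, h3, h4]

lemma hasRadius_eliminate (a M : ℤ) : HasRadius 3 (eliminate a M) := by
  intro u v j k huv
  have h0 : u j = v k := by simpa using huv 0 (by simp) (by simp)
  simp only [eliminate]
  rw [h0, carry_congr (j := j) (k := k) (y := fun i => ⌊v i⌋),
    carry_congr (j := j + 1) (k := k + 1) (y := fun i => ⌊v i⌋),
    carry_congr (j := j - 1) (k := k - 1) (y := fun i => ⌊v i⌋)]
  all_goals
    intro i hi hi'
    try simp only [sub_eq_add_neg, add_assoc]
    rw [huv _ (by push_cast; omega) (by push_cast; omega)]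

lemma carry_digit_mem {a m M L N : ℤ} (ha : 3 ≤ a) (hmM : M - m + 1 = a) (hL : L ≤ m)
    (hN : M ≤ N) {x : ℤ → ℤ} (hx : ∀ j, x j ∈ Set.Icc L (N + 1)) (j : ℤ) :
    x j + (-a * carry M x j + carry M x (j + 1) + carry M x (j - 1)) ∈ Set.Icc L N := by
  have h0 := hx j
  simp only [Set.mem_Icc] at h0 ⊢
  have e1 : ∀ i : ℤ, i + 1 + 1 = i + 2 := fun i => by ring
  have e2 : ∀ i : ℤ, i - 1 - 1 = i - 2 := fun i => by ring
  simp only [carry, Carry, PrimaryCarry, e1, e2, add_sub_cancel_right, sub_add_cancel]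
  generalize x (j + 1) = x1
  generalize x (j + 2) = x2
  generalize x (j + 1 + 2) = x3
  generalize x (j - 1) = y1
  generalize x (j - 2) = y2
  generalize x (j - 1 - 2) = y3
  generalize x j = x0 at *
  split_ifs <;> simp only [mul_one, mul_zero, add_zero, zero_add] <;> omega

lemma support_carry_finite {M : ℤ} (hM : 1 ≤ M) {x : ℤ → ℤ} (hx : (Function.support x).Finite) :
    (Function.support (carry M x)).Finite := by
  refine (hx.union (hx.preimage (add_left_injective (1 : ℤ)).injOn)).subset fun j hj => ?_
  simp only [Function.mem_support, carry, Carry, PrimaryCarry, Set.mem_union,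
    Set.mem_preimage] at hj ⊢
  omega

lemma seqValue_carry {a : ℤ} {β : ℝ} (hβ : 1 < β) (hroot : β ^ 2 = (a : ℝ) * β - 1)
    {u q : ℤ → ℝ} (hu : (Function.support u).Finite) (hq : (Function.support q).Finite) :
    (Function.support fun j => u j + (-a * q j + q (j + 1) + q (j - 1))).Finite ∧
    seqValue β (fun j => u j + (-a * q j + q (j + 1) + q (j - 1))) = seqValue β u := by
  have hβ0 : β ≠ 0 := by positivity
  have f1 : (Function.support fun j => q (j + 1)).Finite :=
    hq.preimage (add_left_injective (1 : ℤ)).injOn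
  have f2 : (Function.support fun j => q (j - 1)).Finite :=
    hq.preimage (sub_left_injective (b := (1 : ℤ))).injOn
  have fm : ∀ {w : ℤ → ℝ}, (Function.support w).Finite → ∀ g : ℤ → ℝ,
      (Function.support fun j => w j * g j).Finite := fun h g =>
    h.subset (Function.support_mul_subset_left _ _)
  refine ⟨((hu.union hq).union (f1.union f2)).subset fun j hj => ?_, ?_⟩
  · by_contra hc
    simp only [Set.mem_union, Function.mem_support, not_or, not_not] at hc hj
    obtain ⟨⟨h1, h2⟩, h3, h4⟩ := hc
    simp [h1, h2, h3, h4] at hj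
  · have s1 : ∑ᶠ j : ℤ, q (j + 1) * β ^ j = ∑ᶠ j : ℤ, q j * β ^ (j - 1) := by
      rw [← finsum_comp_equiv (Equiv.addRight (1 : ℤ)) (f := fun j => q j * β ^ (j - 1))]
      simp
    have s2 : ∑ᶠ j : ℤ, q (j - 1) * β ^ j = ∑ᶠ j : ℤ, q j * β ^ (j + 1) := by
      rw [← finsum_comp_equiv (Equiv.subRight (1 : ℤ)) (f := fun j => q j * β ^ (j + 1))]
      simp
    have key : ∀ j : ℤ, q j * (-a * β ^ j) + q j * β ^ (j - 1) + q j * β ^ (j + 1) = 0 := by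
      intro j
      have hj : β ^ j = β ^ (j - 1) * β := by rw [← zpow_add_one₀ hβ0, sub_add_cancel]
      rw [zpow_add_one₀ hβ0, hj]
      linear_combination q j * β ^ (j - 1) * hroot
    have split : ∀ j : ℤ, (u j + (-a * q j + q (j + 1) + q (j - 1))) * β ^ j
        = u j * β ^ j + (q j * (-a * β ^ j) + q (j + 1) * β ^ j + q (j - 1) * β ^ j) :=
      fun j => by ring
    have g3 : (Function.support fun j : ℤ => q j * (-a * β ^ j) + q (j + 1) * β ^ j).Finite :=
      ((fm hq _).union (fm f1 _)).subset (Function.support_add _ _)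
    have g4 : (Function.support fun j : ℤ => q j * (-a * β ^ j) + q j * β ^ (j - 1)).Finite :=
      ((fm hq _).union (fm hq _)).subset (Function.support_add _ _)
    simp only [seqValue, split]
    rw [finsum_add_distrib (fm hu _)
        ((g3.union (fm f2 _)).subset (Function.support_add _ _)),
      finsum_add_distrib g3 (fm f2 _), finsum_add_distrib (fm hq _) (fm f1 _), s1, s2,
      ← finsum_add_distrib (fm hq _) (fm hq _), ← finsum_add_distrib g4 (fm hq _)]
    simp only [key, finsum_zero, add_zero]

lemma parallelConversion_eliminate {a m M L N : ℤ} {β : ℝ} (ha : 3 ≤ a) (hβ : 1 < β)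
    (hroot : β ^ 2 = (a : ℝ) * β - 1) (hmM : M - m + 1 = a) (hM : 1 ≤ M) (hL : L ≤ m)
    (hN : M ≤ N) : ParallelConversion β (intAlphabet L (N + 1)) (intAlphabet L N) := by
  refine parallelConversion_iff.2 ⟨3, eliminate a M, hasRadius_eliminate a M, fun u hu j => ?_,
    fun u hu hf => ?_⟩
  · choose x hx hxu using hu
    obtain rfl : (fun j => (x j : ℝ)) = u := funext hxu
    refine ⟨_, carry_digit_mem ha hmM hL hN hx j, ?_⟩
    simp [eliminate]
  · have := seqValue_carry hβ hroot hf (q := fun j => (carry M (fun i => ⌊u i⌋) j : ℝ)) ?_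
    · have hE : eliminate a M u = fun j => u j + (-a * (carry M (fun i => ⌊u i⌋) j : ℝ)
          + carry M (fun i => ⌊u i⌋) (j + 1) + carry M (fun i => ⌊u i⌋) (j - 1)) := by
        funext j
        simp [eliminate]
      rwa [hE]
    · have h1 : (Function.support fun i => ⌊u i⌋).Finite :=
        hf.subset fun i hi hi' => hi (by simp [hi'])
      exact (support_carry_finite hM h1).subset fun i hi hi' => hi (by simp [hi'])

lemma parallelConversion_upper {a m M L : ℤ} {β : ℝ} (ha : 3 ≤ a) (hβ : 1 < β)
    (hroot : β ^ 2 = (a : ℝ) * β - 1) (hmM : M - m + 1 = a) (hM : 1 ≤ M) (hL : L ≤ m) (k : ℕ) :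
    ParallelConversion β (intAlphabet L (M + k)) (intAlphabet L M) := by
  induction k with
  | zero => simpa using ParallelConversion.refl β _
  | succ k ih =>
    have := parallelConversion_eliminate ha hβ hroot hmM hM hL (N := M + k) (by omega)
    rw [Nat.cast_succ, ← add_assoc]
    exact this.trans ih

lemma parallelConversion_double_max {a m M L : ℤ} {β : ℝ} (ha : 3 ≤ a) (hβ : 1 < β)
    (hroot : β ^ 2 = (a : ℝ) * β - 1) (hmM : M - m + 1 = a) (hM : 0 ≤ M) (hL : L ≤ m) :
    ParallelConversion β (intAlphabet L (2 * M)) (intAlphabet L M) := by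
  obtain rfl | hM' := hM.eq_or_lt
  · exact ParallelConversion.refl β _
  · have := parallelConversion_upper ha hβ hroot hmM hM' hL M.toNat
    rwa [Int.toNat_of_nonneg hM, ← two_mul] at this

lemma parallelAddition_of_card_eq {a m M : ℤ} {β : ℝ} (ha : 3 ≤ a) (hβ : 1 < β)
    (hroot : β ^ 2 = (a : ℝ) * β - 1) (hm : m ≤ 0) (hM : 0 ≤ M) (hmM : M - m + 1 = a) :
    ParallelAddition β (intAlphabet m M) := by
  have h1 := parallelConversion_double_max ha hβ hroot hmM hM (L := 2 * m) (by omega)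
  have h2 := (parallelConversion_double_max ha hβ hroot (m := -M) (M := -m) (L := -M)
    (by omega) (by omega) le_rfl).neg
  rw [neg_intAlphabet, neg_intAlphabet, mul_neg, neg_neg, neg_neg, neg_neg] at h2
  rw [ParallelAddition, intAlphabet_add (hm.trans hM)]
  exact h1.trans h2

lemma HasRadius.map_zero {R : ℕ} {φ : (ℤ → ℝ) → ℤ → ℝ} (h : HasRadius R φ)
    (hf : (Function.support (φ 0)).Finite) (j : ℤ) : φ 0 j = 0 := by
  by_contra hj
  refine Set.infinite_univ (hf.subset fun k _ => ?_)
  rw [Function.mem_support, h 0 0 k j fun _ _ _ => rfl]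
  exact hj

lemma seqValue_eq_sum {β : ℝ} (hβ : β ≠ 0) {u : ℤ → ℝ} {c : ℤ} {n : ℕ}
    (hu : ∀ j, (j < c ∨ c + n ≤ j) → u j = 0) :
    seqValue β u = β ^ c * ∑ i ∈ Finset.range n, u (c + i) * β ^ i := by
  have hinj : Function.Injective fun i : ℕ => c + (i : ℤ) := fun i k h => by simpa using h
  rw [seqValue, finsum_eq_sum_of_support_subset
    (s := (Finset.range n).image fun i : ℕ => c + (i : ℤ)),
    Finset.sum_image fun _ _ _ _ h => hinj h, Finset.mul_sum]
  · refine Finset.sum_congr rfl fun i _ => ?_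
    rw [zpow_add₀ hβ, zpow_natCast]
    ring
  · intro j hj
    have : ¬ (j < c ∨ c + n ≤ j) := fun h => hj (by simp [hu j h])
    simp only [Finset.coe_image, Set.mem_image, Finset.mem_coe, Finset.mem_range]
    exact ⟨(j - c).toNat, by omega, by omega⟩

lemma seqValue_sub {β : ℝ} {u v : ℤ → ℝ} (hu : (Function.support u).Finite)
    (hv : (Function.support v).Finite) :
    seqValue β (u - v) = seqValue β u - seqValue β v := by
  simp only [seqValue, Pi.sub_apply, sub_mul]
  exact finsum_sub_distrib (hu.subset (Function.support_mul_subset_left _ _))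
    (hv.subset (Function.support_mul_subset_left _ _))

lemma HasRadius.sum_sub {β : ℝ} (hβ : β ≠ 0) {A B : Set ℝ} {R : ℕ} {φ : (ℤ → ℝ) → ℤ → ℝ}
    (h : HasRadius R φ) (hc : IsDigitSetConversion β A B φ) (hA : (0 : ℝ) ∈ A) {u v : ℤ → ℝ}
    (hu : ∀ j, u j ∈ A) (hv : ∀ j, v j ∈ A) {n : ℕ} (huv : ∀ j : ℤ, (j < 0 ∨ n ≤ j) → u j = v j) :
    ∑ i ∈ Finset.range (n + 2 * R), (φ u (-R + i) - φ v (-R + i)) * β ^ i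
      = β ^ R * ∑ i ∈ Finset.range n, (u i - v i) * β ^ i := by
  classical
  set trunc : (ℤ → ℝ) → ℤ → ℝ := fun w j => if -(2 * R : ℤ) ≤ j ∧ j < n + 2 * R then w j else 0
    with htrunc
  have memA : ∀ w : ℤ → ℝ, (∀ j, w j ∈ A) → ∀ j, trunc w j ∈ A := fun w hw j => by
    simp only [htrunc]; split_ifs; exacts [hw j, hA]
  have fin : ∀ w : ℤ → ℝ, (Function.support (trunc w)).Finite := fun w =>
    (Set.finite_Ico (-(2 * R : ℤ)) (n + 2 * R)).subset fun j hj => by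
      by_contra hj'
      exact hj (if_neg hj')
  have φeq : ∀ w : ℤ → ℝ, ∀ i ∈ Finset.range (n + 2 * R),
      φ w (-R + i) = φ (trunc w) (-R + i) := fun w i hi => by
    refine h _ _ _ _ fun l hl hl' => ?_
    rw [Finset.mem_range] at hi
    simp only [htrunc]
    rw [if_pos (by omega)]
  obtain ⟨fu, vu⟩ := hc.2 _ (memA u hu) (fin u)
  obtain ⟨fv, vv⟩ := hc.2 _ (memA v hv) (fin v)
  have e1 := seqValue_sub (β := β) fu fv
  rw [vu, vv, ← seqValue_sub (fin u) (fin v),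
    seqValue_eq_sum hβ (u := trunc u - trunc v) (c := 0) (n := n),
    seqValue_eq_sum hβ (u := φ (trunc u) - φ (trunc v)) (c := -R) (n := n + 2 * R)] at e1
  · have e2 : ∑ i ∈ Finset.range (n + 2 * R), (φ u (-R + i) - φ v (-R + i)) * β ^ i
        = ∑ i ∈ Finset.range (n + 2 * R), (φ (trunc u) - φ (trunc v)) (-R + i) * β ^ i :=
      Finset.sum_congr rfl fun i hi => by rw [φeq u i hi, φeq v i hi, Pi.sub_apply]
    have e3 : ∑ i ∈ Finset.range n, (trunc u - trunc v) (0 + i) * β ^ i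
        = ∑ i ∈ Finset.range n, (u i - v i) * β ^ i :=
      Finset.sum_congr rfl fun i hi => by
        rw [Finset.mem_range] at hi
        simp only [htrunc, Pi.sub_apply, zero_add]
        rw [if_pos (by omega), if_pos (by omega)]
    rw [e2, ← e3]
    rw [zpow_neg, zpow_natCast, zpow_zero, one_mul] at e1
    rw [← e1]
    field_simp
  · intro j hj
    rw [Pi.sub_apply, sub_eq_zero]
    refine h _ _ _ _ fun l hl hl' => ?_
    simp only [htrunc]
    rw [huv (j + l) (by push_cast at hj; omega)]
  · intro j hj
    rw [Pi.sub_apply, sub_eq_zero]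
    simp only [htrunc]
    rw [huv j (by omega)]

lemma not_root_of_linear {a : ℤ} {β : ℝ} (hβ : 1 < β) (hroot : β ^ 2 = (a : ℝ) * β - 1)
    {c d : ℤ} (h : (c : ℝ) * β + d = 0) : c = 0 ∧ d = 0 := by
  by_cases hc : c = 0
  · subst hc
    simpa using h
  · exfalso
    have hc' : (c : ℝ) ≠ 0 := by exact_mod_cast hc
    have h_int : IsIntegral ℤ (-d / c : ℚ) := by
      refine ⟨Polynomial.X ^ 2 - Polynomial.C a * Polynomial.X + 1, by monicity!, ?_⟩
      have : β = ((-d / c : ℚ) : ℝ) := by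
        push_cast
        field_simp
        linarith
      have h2 : ((-d / c : ℚ)) ^ 2 = a * (-d / c : ℚ) - 1 := by
        rw [this] at hroot
        exact_mod_cast hroot
      simp only [Polynomial.eval₂_add, Polynomial.eval₂_sub, Polynomial.eval₂_mul,
        Polynomial.eval₂_pow, Polynomial.eval₂_X, Polynomial.eval₂_C, Polynomial.eval₂_one]
      rw [h2]
      simp
    obtain ⟨n, hn⟩ := IsIntegrallyClosed.isIntegral_iff.1 h_int
    have hβn : β = n := by
      have h3 : ((n : ℚ) : ℝ) = ((-d / c : ℚ) : ℝ) := by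
        rw [← hn]
        simp
      push_cast at h3
      rw [h3]
      field_simp
      linarith
    rw [hβn] at hroot hβ
    have h4 : n ^ 2 = a * n - 1 := by exact_mod_cast hroot
    have h5 : 1 < n := by exact_mod_cast hβ
    have h6 : n ∣ 1 := ⟨a - n, by linarith⟩
    exact absurd (Int.le_of_dvd one_pos h6) (by omega)

open Polynomial in
lemma eval_one_dvd_of_aeval_eq_zero {a : ℤ} {β : ℝ} (hβ : 1 < β)
    (hroot : β ^ 2 = (a : ℝ) * β - 1) {P : ℤ[X]} (hP : aeval β P = 0) : a - 2 ∣ P.eval 1 := by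
  set f : ℤ[X] := X ^ 2 - C a * X + 1 with hf
  have hmon : f.Monic := by rw [hf]; monicity!
  have hdeg : f.natDegree = 2 := by rw [hf]; compute_degree!
  have hfβ : aeval β f = 0 := by simp [hf, hroot]
  have hlt : (P %ₘ f).natDegree ≤ 1 := by
    have := natDegree_modByMonic_lt P hmon (fun h => by simp [h] at hdeg)
    omega
  obtain ⟨c, d, hcd⟩ := exists_eq_X_add_C_of_natDegree_le_one hlt
  have hmod := modByMonic_add_div P f
  have hr : aeval β (P %ₘ f) = 0 := by
    rw [← hmod] at hP
    simpa [hfβ] using hP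
  rw [hcd] at hr
  obtain ⟨rfl, rfl⟩ := not_root_of_linear hβ hroot (c := c) (d := d) (by simpa using hr)
  rw [hcd] at hmod
  rw [← hmod]
  exact ⟨-(P /ₘ f).eval 1, by simp [hf]; ring⟩

lemma intCast_mem_add {m M k : ℤ} (hm : m ≤ 0) (hM : 1 ≤ M) (hk : 0 ≤ k) (hk' : k ≤ M + 1) :
    (k : ℝ) ∈ intAlphabet m M + intAlphabet m M := by
  rw [intAlphabet_add (by omega)]
  exact ⟨k, ⟨by omega, by omega⟩, rfl⟩

lemma not_parallelAddition_of_card_lt {a m M : ℤ} {β : ℝ} (hβ : 1 < β)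
    (hroot : β ^ 2 = (a : ℝ) * β - 1) (hm : m ≤ 0) (hM : 1 ≤ M) (hmM : M - m + 1 < a) :
    ¬ ParallelAddition β (intAlphabet m M) := by
  intro hadd
  obtain ⟨R, φ, hφ, hc⟩ := parallelConversion_iff.1 hadd
  have hβ0 : β ≠ 0 := by positivity
  have hβ1 : 0 < β - 1 := by linarith
  have mem0 : (0 : ℝ) ∈ intAlphabet m M + intAlphabet m M := by
    simpa using intCast_mem_add (k := 0) hm hM le_rfl (by omega)
  have memM : (M : ℝ) ∈ intAlphabet m M + intAlphabet m M :=
    intCast_mem_add hm hM (by omega) (by omega)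
  have memM1 : (M : ℝ) + 1 ∈ intAlphabet m M + intAlphabet m M := by
    simpa using intCast_mem_add (k := M + 1) hm hM (by omega) le_rfl
  have φ0 := hφ.map_zero (hc.2 0 (fun _ => mem0) (by simp)).1
  -- the constant half-line, its shift, and the digits of its image
  set h : ℤ → ℝ := fun j => if 0 ≤ j then (M : ℝ) else 0 with hh
  set h' : ℤ → ℝ := fun j => if 1 ≤ j then (M : ℝ) else 0 with hh'
  have hmem : ∀ j, h j ∈ intAlphabet m M + intAlphabet m M := fun j => by
    simp only [hh]; split_ifs <;> assumption
  have hmem' : ∀ j, h' j ∈ intAlphabet m M + intAlphabet m M := fun j => by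
    simp only [hh']; split_ifs <;> assumption
  choose g hg hgφ using fun i : ℕ => hc.1 h hmem (-R + i)
  simp only at hgφ
  have hconst : ∀ i, 2 * R ≤ i → g i = g (2 * R) := fun i hi => by
    have : (g i : ℝ) = g (2 * R) := by
      rw [hgφ, hgφ]
      refine hφ _ _ _ _ fun l hl hl' => ?_
      simp only [hh]
      rw [if_pos (by omega), if_pos (by push_cast; omega)]
    exact_mod_cast this
  set y := g (2 * R) with hy
  have hshift : ∀ i : ℕ, φ h' (-R + (i + 1 : ℕ)) = g i := fun i => by
    rw [hgφ]
    refine hφ _ _ _ _ fun l hl hl' => ?_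
    simp only [hh, hh']
    congr 1
    simp only [eq_iff_iff]
    push_cast
    omega
  have hshift0 : φ h' (-R + (0 : ℕ)) = 0 := by
    rw [← φ0 0]
    refine hφ _ _ _ _ fun l hl hl' => ?_
    simp only [hh', Pi.zero_apply]
    rw [if_neg (by push_cast; omega)]
  set G : ℝ := ∑ i ∈ Finset.range (2 * R), (g i : ℝ) * β ^ i with hG
  have hGeq : (β - 1) * G = y * β ^ (2 * R) - M * β ^ R := by
    have := hφ.sum_sub hβ0 hc mem0 hmem hmem' (n := 1) (fun j hj => by
      simp only [hh, hh']
      congr 1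
      simp only [eq_iff_iff]
      omega)
    simp only [sub_mul, Finset.sum_sub_distrib, ← hgφ] at this
    rw [add_comm 1, Finset.sum_range_succ, Finset.sum_range_succ', ← hG] at this
    simp only [hshift, hshift0, pow_succ, ← mul_assoc, ← Finset.sum_mul, ← hG] at this
    simp [hh, hh', ← hy] at this
    linarith
  have hgeom : ∀ n : ℕ, (∑ i ∈ Finset.range n, β ^ i) * (β - 1) = β ^ n - 1 := geom_sum_mul β
  have hRpos : 0 < β ^ R := by positivity
  have hMR : (1 : ℝ) ≤ M := by exact_mod_cast hM
  have hmR : (m : ℝ) ≤ 0 := by exact_mod_cast hm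
  have hdvd : a - 2 ∣ M - y := by
    have := eval_one_dvd_of_aeval_eq_zero hβ hroot
      (P := (Polynomial.X - 1) * ∑ i ∈ Finset.range (2 * R), Polynomial.C (g i) * Polynomial.X ^ i
        - Polynomial.C y * Polynomial.X ^ (2 * R) + Polynomial.C M * Polynomial.X ^ R) (by
          simp [← hG, hGeq])
    simpa [sub_eq_add_neg, add_comm] using this
  have hym : y ≠ m := by
    intro hym
    have h1 : (m : ℝ) * ∑ i ∈ Finset.range (2 * R), β ^ i ≤ G := by
      rw [Finset.mul_sum]
      refine Finset.sum_le_sum fun i _ => ?_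
      have : (m : ℝ) ≤ g i := by exact_mod_cast (hg i).1
      gcongr
    have h2 := mul_le_mul_of_nonneg_left h1 hβ1.le
    rw [hGeq, hym] at h2
    have h3 := hgeom (2 * R)
    have h4 : (m : ℝ) * ((∑ i ∈ Finset.range (2 * R), β ^ i) * (β - 1))
      = m * (β ^ (2 * R) - 1) := by rw [h3]
    nlinarith
  have hyM : y ≠ M := by
    intro hyM
    obtain ⟨K, hK⟩ := pow_unbounded_of_one_lt ((M : ℝ) + 1) hβ
    set w : ℤ → ℝ := fun j => if 0 ≤ j then (if j < K then (M : ℝ) + 1 else M) else 0 with hw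
    have wmem : ∀ j, w j ∈ intAlphabet m M + intAlphabet m M := fun j => by
      simp only [hw]; split_ifs <;> assumption
    have key := hφ.sum_sub hβ0 hc mem0 wmem hmem (n := K) (fun j hj => by
      simp only [hw, hh]
      split_ifs <;> first | rfl | omega)
    have h1 : ∑ i ∈ Finset.range K, (w i - h i) * β ^ i = ∑ i ∈ Finset.range K, β ^ i := by
      refine Finset.sum_congr rfl fun i hi => ?_
      rw [Finset.mem_range] at hi
      simp [hw, hh, hi]
    have h2 : ∑ i ∈ Finset.range (K + 2 * R), (φ w (-R + i) - φ h (-R + i)) * β ^ i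
        ≤ ∑ i ∈ Finset.range (K + 2 * R), ((M : ℝ) - g i) * β ^ i := by
      refine Finset.sum_le_sum fun i _ => ?_
      obtain ⟨k, hk, hkφ⟩ := hc.1 w wmem (-R + i)
      have : (k : ℝ) ≤ M := by exact_mod_cast hk.2
      rw [← hgφ, ← hkφ]
      gcongr
    have h3 : ∑ i ∈ Finset.range (K + 2 * R), ((M : ℝ) - g i) * β ^ i
        = ∑ i ∈ Finset.range (2 * R), ((M : ℝ) - g i) * β ^ i := by
      symm
      refine Finset.sum_subset (Finset.range_mono (by omega)) fun i _ hi => ?_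
      rw [hconst i (by simpa using hi), hyM, sub_self, zero_mul]
    rw [h3, key, h1] at h2
    simp only [sub_mul, Finset.sum_sub_distrib, ← hG, ← Finset.mul_sum] at h2
    have h4 := mul_le_mul_of_nonneg_right h2 hβ1.le
    have h5 : β ^ R * (∑ i ∈ Finset.range K, β ^ i) * (β - 1) = β ^ R * (β ^ K - 1) := by
      rw [mul_assoc, hgeom]
    have h6 : (M * (∑ i ∈ Finset.range (2 * R), β ^ i) - G) * (β - 1)
        = M * (β ^ R - 1) := by
      rw [sub_mul, mul_assoc, hgeom, mul_comm G, hGeq, hyM]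
      ring
    rw [h5, h6] at h4
    nlinarith
  have hy1 := (hg (2 * R)).1
  have hy2 := (hg (2 * R)).2
  rw [← hy] at hy1 hy2
  have := Int.le_of_dvd (by omega) hdvd
  omega

/-- Theorem (quadratic Pisot unit, case `β² = aβ - 1`): for `a ≥ 3` and `β > 1` the
larger root of `X² - aX + 1`, every alphabet of contiguous integers containing `0` of
cardinality `a` allows parallel addition in base `β`, and no alphabet of contiguous
integers containing `0` and `1` of cardinality less than `a` does. -/
theorem quadratic_pisot_unit_minus_minimal_alphabet
    (a : ℤ) (ha : 3 ≤ a) (β : ℝ) (hβ : 1 < β)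
    (hroot : β ^ 2 = (a : ℝ) * β - 1) :
    (∀ m M : ℤ, m ≤ 0 → 0 ≤ M → M - m + 1 = a →
      ParallelAddition β (intAlphabet m M)) ∧
    (∀ m M : ℤ, m ≤ 0 → 1 ≤ M → M - m + 1 < a →
      ¬ ParallelAddition β (intAlphabet m M)) := by
  exact ⟨fun _ _ hm hM hmM => parallelAddition_of_card_eq ha hβ hroot hm hM hmM,
    fun _ _ hm hM hmM => not_parallelAddition_of_card_lt hβ hroot hm hM hmM⟩
end

section
/- Let a and b be co-prime positive integers with a > b ≥ 1 and let β = a/b. Then addition on Fin_A(β) with alphabet A = {0, 1, …, a+b−1} can be performed in parallel. -/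
open scoped Pointwise

/-- The quotient digit of `x` in the carry rule: `1` if `x ≥ c` and `0` otherwise. -/
noncomputable def carryDigit (c x : ℝ) : ℝ := if c ≤ x then 1 else 0

/-- One parallel carry step for the rewriting rule `d β - c = 0`: every digit that is at
least `c` is lowered by `c`, and its left neighbour is raised by `d`. -/
noncomputable def carryStep (c d : ℝ) (u : ℤ → ℝ) (j : ℤ) : ℝ :=
  u j - c * carryDigit c (u j) + d * carryDigit c (u (j - 1))

theorem isLocallyRealized_iterate_carryStep (c d : ℝ) (n : ℕ) :
    ∃ Φ : (Fin (n + 1) → ℝ) → ℝ, IsLocallyRealized (n + 1) (carryStep c d)^[n] Φ := by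
  suffices h : ∃ Φ : (Fin (n + 1) → ℝ) → ℝ, ∀ (u : ℤ → ℝ) (j : ℤ),
      (carryStep c d)^[n] u j = Φ fun i => u (j - ((i : ℕ) : ℤ)) by
    obtain ⟨Φ, hΦ⟩ := h
    exact ⟨Φ, n, 0, by simp, fun u j => by simp [hΦ]⟩
  induction n with
  | zero => exact ⟨fun v => v 0, fun u j => by simp⟩
  | succ n ih =>
    obtain ⟨Φ, hΦ⟩ := ih
    refine ⟨fun v => Φ (fun i => v i.castSucc) - c * carryDigit c (Φ fun i => v i.castSucc) +
      d * carryDigit c (Φ fun i => v i.succ), fun u j => ?_⟩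
    have hsucc : (fun i : Fin (n + 1) => u (j - ((i.succ : ℕ) : ℤ))) =
        fun i : Fin (n + 1) => u (j - 1 - ((i : ℕ) : ℤ)) := by
      funext i
      congr 1
      push_cast [Fin.val_succ]
      ring
    rw [Function.iterate_succ_apply', carryStep, hΦ, hΦ, ← hsucc]
    rfl

theorem IsDigitSetConversion.comp {β : ℝ} {A B C : Set ℝ} {φ ψ : (ℤ → ℝ) → ℤ → ℝ}
    (hψ : IsDigitSetConversion β B C ψ) (hφ : IsDigitSetConversion β A B φ) :
    IsDigitSetConversion β A C (ψ ∘ φ) := by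
  refine ⟨fun u hu => hψ.1 _ (hφ.1 u hu), fun u hu hfin => ?_⟩
  obtain ⟨hfin', hval⟩ := hφ.2 u hu hfin
  obtain ⟨hfin'', hval'⟩ := hψ.2 _ (hφ.1 u hu) hfin'
  exact ⟨hfin'', hval'.trans hval⟩

theorem IsDigitSetConversion.mono {β : ℝ} {A A' B : Set ℝ} {φ : (ℤ → ℝ) → ℤ → ℝ}
    (hφ : IsDigitSetConversion β A B φ) (hA : A' ⊆ A) : IsDigitSetConversion β A' B φ :=
  ⟨fun u hu => hφ.1 u fun j => hA (hu j), fun u hu => hφ.2 u fun j => hA (hu j)⟩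

theorem isDigitSetConversion_id (β : ℝ) (A : Set ℝ) : IsDigitSetConversion β A A id :=
  ⟨fun _ hu => hu, fun _ _ hfin => ⟨hfin, rfl⟩⟩

theorem intAlphabet_add_subset (m M m' M' : ℤ) :
    intAlphabet m M + intAlphabet m' M' ⊆ intAlphabet (m + m') (M + M') := by
  rintro _ ⟨_, ⟨k, ⟨hk, hk'⟩, rfl⟩, _, ⟨l, ⟨hl, hl'⟩, rfl⟩, rfl⟩
  exact ⟨k + l, ⟨by lia, by lia⟩, by push_cast; rfl⟩

theorem finite_support_carryDigit {c : ℝ} (hc : 0 < c) {u : ℤ → ℝ}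
    (hu : (Function.support u).Finite) :
    (Function.support fun j => carryDigit c (u j)).Finite := by
  refine hu.subset fun j hj hj0 => hj ?_
  simp only [carryDigit, hj0, if_neg hc.not_ge]

theorem finite_support_carryStep {c : ℝ} (hc : 0 < c) (d : ℝ) {u : ℤ → ℝ}
    (hu : (Function.support u).Finite) : (Function.support (carryStep c d u)).Finite := by
  have hq := finite_support_carryDigit hc hu
  refine (hu.union (hq.union (hq.preimage (sub_left_injective (b := (1 : ℤ))).injOn))).subset
    fun j hj => ?_
  by_contra h
  simp only [Set.mem_union, Set.mem_preimage, Function.mem_support, not_or, not_not] at h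
  exact hj (by rw [carryStep, h.2.1, h.2.2, h.1]; simp)

theorem seqValue_carryStep {β c d : ℝ} (hβ : β ≠ 0) (hc : 0 < c) (hcd : d * β = c) {u : ℤ → ℝ}
    (hu : (Function.support u).Finite) : seqValue β (carryStep c d u) = seqValue β u := by
  set q : ℤ → ℝ := fun j => d * β * carryDigit c (u j) * β ^ j with hq
  have hqfin : (Function.support q).Finite :=
    (finite_support_carryDigit hc hu).subset fun j hj h0 => hj (by
      simp only at h0
      simp [hq, h0])
  have hufin : (Function.support fun j => u j * β ^ j).Finite :=
    hu.subset (Function.support_mul_subset_left _ _)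
  have hshift : (Function.support fun j => q (j - 1)).Finite :=
    hqfin.preimage (sub_left_injective (b := (1 : ℤ))).injOn
  have hsum : ∑ᶠ j, q (j - 1) = ∑ᶠ j, q j := finsum_comp_equiv (Equiv.subRight (1 : ℤ))
  have hdigit : (fun j => carryStep c d u j * β ^ j) =
      fun j => (u j * β ^ j - q j) + q (j - 1) := by
    funext j
    simp only [carryStep, hq, zpow_sub_one₀ hβ, hcd]
    rw [← hcd]
    field_simp
  rw [seqValue, hdigit, finsum_add_distrib _ hshift, finsum_sub_distrib hufin hqfin, hsum,
    sub_add_cancel, seqValue]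
  exact (hufin.union hqfin).subset (Function.support_sub _ _)

theorem carryStep_mem_intAlphabet {a b : ℕ} (hab : b < a) {n : ℕ} {u : ℤ → ℝ}
    (hu : ∀ j, u j ∈ intAlphabet 0 ((a : ℤ) + b - 1 + (n + 1 : ℕ))) (j : ℤ) :
    carryStep a b u j ∈ intAlphabet 0 ((a : ℤ) + b - 1 + n) := by
  have hcast (k : ℤ) : carryDigit a (k : ℝ) = ((if (a : ℤ) ≤ k then 1 else 0 : ℤ) : ℝ) := by
    have : (a : ℝ) ≤ k ↔ (a : ℤ) ≤ k := by exact_mod_cast Iff.rfl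
    simp [carryDigit, this]
  obtain ⟨k, ⟨hk, hk'⟩, hkj⟩ := hu j
  obtain ⟨l, -, hlj⟩ := hu (j - 1)
  simp only at hkj hlj
  refine ⟨k - a * (if (a : ℤ) ≤ k then 1 else 0) + b * (if (a : ℤ) ≤ l then 1 else 0), ?_, ?_⟩
  · constructor <;> split_ifs <;> push_cast at hk' <;> lia
  · rw [carryStep, ← hkj, ← hlj, hcast, hcast]
    push_cast
    rfl

theorem isDigitSetConversion_carryStep {a b : ℕ} (hb : 1 ≤ b) (hab : b < a) (n : ℕ) :
    IsDigitSetConversion ((a : ℝ) / b) (intAlphabet 0 ((a : ℤ) + b - 1 + (n + 1 : ℕ)))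
      (intAlphabet 0 ((a : ℤ) + b - 1 + n)) (carryStep a b) := by
  have ha0 : (0 : ℝ) < a := by exact_mod_cast hb.trans_lt hab |>.pos
  have hb0 : (0 : ℝ) < b := by exact_mod_cast hb
  exact ⟨fun u hu => carryStep_mem_intAlphabet hab hu, fun u _ hfin =>
    ⟨finite_support_carryStep ha0 _ hfin,
      seqValue_carryStep (div_pos ha0 hb0).ne' ha0 (mul_div_cancel₀ _ hb0.ne') hfin⟩⟩

theorem isDigitSetConversion_iterate_carryStep {a b : ℕ} (hb : 1 ≤ b) (hab : b < a) (n : ℕ) :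
    IsDigitSetConversion ((a : ℝ) / b) (intAlphabet 0 ((a : ℤ) + b - 1 + n))
      (intAlphabet 0 ((a : ℤ) + b - 1)) (carryStep a b)^[n] := by
  induction n with
  | zero => simpa using isDigitSetConversion_id _ _
  | succ n ih =>
    rw [Function.iterate_succ]
    exact ih.comp (isDigitSetConversion_carryStep hb hab n)

/-- Proposition (positive rational base): for co-prime positive integers `a > b ≥ 1`,
addition in base `β = a/b` on the alphabet `{0, 1, …, a+b-1}` can be performed in
parallel. -/
theorem rational_base_parallelAddition
    (a b : ℕ) (hco : Nat.Coprime a b) (hb : 1 ≤ b) (hab : b < a) :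
    ParallelAddition ((a : ℝ) / (b : ℝ)) (intAlphabet 0 ((a : ℤ) + (b : ℤ) - 1)) := by
  obtain ⟨Φ, hΦ⟩ := isLocallyRealized_iterate_carryStep a b (a + b - 1)
  refine ⟨_, _, Φ, hΦ, (isDigitSetConversion_iterate_carryStep hb hab (a + b - 1)).mono ?_⟩
  convert intAlphabet_add_subset 0 ((a : ℤ) + b - 1) 0 ((a : ℤ) + b - 1) using 2
  · simp
  · lia
end
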